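/- arXiv:1406.0781 — 3 statements merged into one kernel-verified Lean document; each statement's English description precedes it below -/
import Mathlib

section
/- (Theorem 2: ψ_{ℤ²}(m) ≥ m+1 for m = 5 or m > 6.) Let m ∈ ℕ with m = 5 or m > 6. If F and F' are distinct finite subsets of ℤ² with |F| = |F'| = n that have equal X-rays in each of m pairwise linearly independent nonzero directions s_1, …, s_m ∈ ℤ², then n ≥ m + 1. -/
/-- The line through `p` in direction `s` in `ℝ^d`. -/
def lineThrough {d : ℕ} (p s : Fin d → ℝ) : Set (Fin d → ℝ) :=
  {x | ∃ t : ℝ, x = p + t • s}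

/-- The real embedding of an integer vector. -/
def castVec {d : ℕ} (x : Fin d → ℤ) : Fin d → ℝ := fun i => (x i : ℝ)

/-- Two sets in `ℤ^d` have equal X-rays in direction `s` if every line parallel
to `s` contains equally many points of each set. -/
def EqualXraysZ {d : ℕ} (F F' : Set (Fin d → ℤ)) (s : Fin d → ℤ) : Prop :=
  ∀ p : Fin d → ℝ,
    {x ∈ F | castVec x ∈ lineThrough p (castVec s)}.ncard =
      {x ∈ F' | castVec x ∈ lineThrough p (castVec s)}.ncard

/-- A family of integer vectors is pairwise linearly independent if no one of them
is a (real) scalar multiple of another. -/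
def PairwiseLinIndepZ {d m : ℕ} (s : Fin m → (Fin d → ℤ)) : Prop :=
  ∀ i j, i ≠ j → ∀ c : ℝ, castVec (s i) ≠ c • castVec (s j)

/-- The two-dimensional cross product of integer vectors. -/
def cross (v w : Fin 2 → ℤ) : ℤ := v 0 * w 1 - v 1 * w 0

/-- The two-dimensional dot product of integer vectors. -/
def dot (v w : Fin 2 → ℤ) : ℤ := v 0 * w 0 + v 1 * w 1

lemma cross_swap (v w : Fin 2 → ℤ) : cross v w = -cross w v := by
  simp only [cross]; ring

lemma cross_neg_left (v w : Fin 2 → ℤ) : cross (-v) w = -cross v w := by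
  simp only [cross, Pi.neg_apply]; ring

lemma cross_neg_right (v w : Fin 2 → ℤ) : cross v (-w) = -cross v w := by
  simp only [cross, Pi.neg_apply]; ring

lemma cross_add_right (v w z : Fin 2 → ℤ) : cross v (w + z) = cross v w + cross v z := by
  simp only [cross, Pi.add_apply]; ring

lemma cross_sub_right (v w z : Fin 2 → ℤ) : cross v (w - z) = cross v w - cross v z := by
  simp only [cross, Pi.sub_apply]; ring

lemma eq_zero_of_cross_eq_zero {v w y : Fin 2 → ℤ} (h : cross v w ≠ 0)
    (hv : cross v y = 0) (hw : cross w y = 0) : y = 0 := by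
  simp only [cross] at *
  have h0 : (v 0 * w 1 - v 1 * w 0) * y 0 = 0 := by linear_combination w 0 * hv - v 0 * hw
  have h1 : (v 0 * w 1 - v 1 * w 0) * y 1 = 0 := by linear_combination w 1 * hv - v 1 * hw
  ext a
  fin_cases a
  · simpa [h] using h0
  · simpa [h] using h1

lemma dot_self_pos {v : Fin 2 → ℤ} (h : v ≠ 0) : 0 < dot v v := by
  by_contra hc
  simp only [dot] at hc
  apply h
  ext a
  fin_cases a
  · simp; nlinarith [sq_nonneg (v 0), sq_nonneg (v 1)]
  · simp; nlinarith [sq_nonneg (v 0), sq_nonneg (v 1)]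

/-- A vector `w` parallel to `v` is a rational multiple of `v`, tested against any `z`. -/
lemma dot_mul_cross {v w : Fin 2 → ℤ} (h : cross v w = 0) (z : Fin 2 → ℤ) :
    dot v v * cross w z = dot v w * cross v z := by
  simp only [cross, dot] at *
  linear_combination (- v 0 * z 0 - v 1 * z 1) * h

lemma dot_ne_zero {v w : Fin 2 → ℤ} (h : cross v w = 0) (hv : v ≠ 0) (hw : w ≠ 0) :
    dot v w ≠ 0 := by
  intro hd
  have hp := dot_self_pos hv
  simp only [cross, dot] at *
  have h0 : (v 0 * v 0 + v 1 * v 1) * w 0 = 0 := by linear_combination v 0 * hd - v 1 * h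
  have h1 : (v 0 * v 0 + v 1 * v 1) * w 1 = 0 := by linear_combination v 1 * hd + v 0 * h
  apply hw
  ext a
  fin_cases a
  · simpa [hp.ne'] using h0
  · simpa [hp.ne'] using h1

/-! ### Periodic integer sequences satisfying a linear recurrence -/

lemma pow_dvd_of_recurrence {p q : ℤ} (hq : 0 < q) (hpq : IsCoprime p q) (n : ℕ) :
    ∀ c : ℤ → ℤ, (∀ k, q * (c (k + 1) + c (k - 1)) = p * c k) → ∀ k, q ^ n ∣ c k := by
  induction n with
  | zero => simp
  | succ n ih =>
    intro c hc k
    choose d hd using ih c hc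
    have hrec : q * (d (k + 1) + d (k - 1)) = p * d k := by
      have := hc k
      rw [hd (k + 1), hd (k - 1), hd k] at this
      apply mul_left_cancel₀ (pow_ne_zero n hq.ne')
      linear_combination this
    have hdvd : q ∣ d k := hpq.symm.dvd_of_dvd_mul_left ⟨_, hrec.symm⟩
    rw [hd k, pow_succ]
    exact mul_dvd_mul_left _ hdvd

/-- A recurrence with rational coefficient satisfied by a nonzero integer sequence, indexed by all
integers, has an integral coefficient. -/
lemma dvd_of_recurrence {p q : ℤ} (hq : 0 < q) {c : ℤ → ℤ}
    (hc : ∀ k, q * (c (k + 1) + c (k - 1)) = p * c k) {k₀ : ℤ} (h0 : c k₀ ≠ 0) : q ∣ p := by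
  obtain ⟨g, p', q', hg, hcop, rfl, rfl⟩ :
      ∃ g p' q' : ℤ, 0 < g ∧ IsCoprime p' q' ∧ p = g * p' ∧ q = g * q' := by
    have hgpos : 0 < Int.gcd p q := Int.gcd_pos_of_ne_zero_right _ hq.ne'
    refine ⟨Int.gcd p q, p / Int.gcd p q, q / Int.gcd p q, by exact_mod_cast hgpos, ?_, ?_, ?_⟩
    · exact Int.isCoprime_iff_gcd_eq_one.2 (Int.gcd_ediv_gcd_ediv_gcd hgpos)
    · exact (Int.mul_ediv_cancel' (Int.gcd_dvd_left ..)).symm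
    · exact (Int.mul_ediv_cancel' (Int.gcd_dvd_right ..)).symm
  have hq' : 0 < q' := pos_of_mul_pos_right hq hg.le
  have hc' : ∀ k, q' * (c (k + 1) + c (k - 1)) = p' * c k := fun k => by
    apply mul_left_cancel₀ hg.ne'
    linear_combination hc k
  have hone : q' = 1 := by
    by_contra hne
    have h2 : 2 ≤ q' := by omega
    have hle := Int.le_of_dvd (abs_pos.2 h0)
      ((dvd_abs _ _).2 (pow_dvd_of_recurrence hq' hcop (c k₀).natAbs c hc' k₀))
    have hlt : ((c k₀).natAbs : ℤ) < 2 ^ (c k₀).natAbs := by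
      exact_mod_cast Nat.lt_two_pow_self
    have hmono : (2 : ℤ) ^ (c k₀).natAbs ≤ q' ^ (c k₀).natAbs :=
      pow_le_pow_left₀ (by norm_num) h2 _
    rw [Int.natCast_natAbs] at hlt
    omega
  rw [hone]
  exact mul_dvd_mul_left _ (one_dvd _)

lemma abs_le_two_of_recurrence {m : ℕ} (hm : 0 < m) {t : ℤ} {c : ℤ → ℤ}
    (hper : ∀ k, c (k + m) = c k) (hc : ∀ k, c (k + 1) + c (k - 1) = t * c k)
    {k₀ : ℤ} (h0 : c k₀ ≠ 0) : |t| ≤ 2 := by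
  have hmod : ∀ k, c (k % m) = c k := fun k => by
    have hp : Function.Periodic c (m : ℤ) := hper
    have := hp.sub_int_mul_eq (x := k) (k / m)
    rw [← this]; congr 1
    have := Int.emod_add_mul_ediv k m
    simp; linarith
  obtain ⟨a, -, hmax⟩ := Finset.exists_max_image (Finset.range m) (fun a => |c a|)
    ⟨0, Finset.mem_range.2 hm⟩
  have hmax' : ∀ k, |c k| ≤ |c a| := fun k => by
    have hm' : (0 : ℤ) < m := by exact_mod_cast hm
    have hlo := Int.emod_nonneg k hm'.ne'
    have hhi := Int.emod_lt_of_pos k hm'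
    have := hmax (k % m).toNat (Finset.mem_range.2 (by omega))
    simp only [Int.toNat_of_nonneg hlo, hmod] at this
    exact this
  have hpos : 0 < |c a| := (abs_pos.2 h0).trans_le (hmax' _)
  have h1 : |t| * |c a| ≤ 2 * |c a| := by
    rw [← abs_mul, ← hc a]
    have := abs_add_le (c (a + 1)) (c (a - 1))
    linarith [hmax' (a + 1), hmax' (a - 1)]
  exact le_of_mul_le_mul_right h1 hpos

lemma const_of_periodic_of_recurrence_two {m : ℕ} (hm : 0 < m) {c : ℤ → ℤ}
    (hper : ∀ k, c (k + m) = c k) (hc : ∀ k, c (k + 1) + c (k - 1) = 2 * c k) :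
    c 1 = c 0 := by
  have hlin : ∀ n : ℕ, c n = c 0 + n * (c 1 - c 0) ∧ c (n + 1) = c 0 + (n + 1) * (c 1 - c 0) := by
    intro n
    induction n with
    | zero => simp
    | succ n ih =>
      refine ⟨by exact_mod_cast ih.2, ?_⟩
      have := hc (n + 1)
      simp only [add_sub_cancel_right] at this
      push_cast
      linear_combination this + 2 * ih.2 - ih.1
  have h1 := (hlin m).1
  have h2 := hper 0
  rw [zero_add] at h2
  have h3 : (m : ℤ) * (c 1 - c 0) = 0 := by linarith
  have hm' : (m : ℤ) ≠ 0 := by exact_mod_cast hm.ne'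
  have := (mul_eq_zero.1 h3).resolve_left hm'
  linarith

/-- The period of a periodic integer sequence with `c (k + 1) + c (k - 1) = t * c k` depends
only on `t`. -/
lemma apply_eq_apply_zero_of_recurrence {m : ℕ} (hm : 0 < m) {t : ℤ} (ht : |t| ≤ 2) {c : ℤ → ℤ}
    (hper : ∀ k, c (k + m) = c k) (hc : ∀ k, c (k + 1) + c (k - 1) = t * c k) :
    (|t| ≠ 1 → c 4 = c 0) ∧ (|t| = 1 → c 6 = c 0) := by
  have h1 := hc 1
  have h2 := hc 2
  have h3 := hc 3
  have h4 := hc 4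
  have h5 := hc 5
  norm_num at h1 h2 h3 h4 h5
  obtain ⟨hlo, hhi⟩ := abs_le.1 ht
  have hcases : t = -2 ∨ t = -1 ∨ t = 0 ∨ t = 1 ∨ t = 2 := by omega
  rcases hcases with rfl | rfl | rfl | rfl | rfl
  · have := const_of_periodic_of_recurrence_two hm (c := fun k => c (2 * k))
      (fun k => by
        rw [show 2 * (k + m) = 2 * k + m + m by ring, hper, hper])
      (fun k => by
        have ha := hc (2 * k + 1)
        have hb := hc (2 * k - 1)
        have hd := hc (2 * k)
        rw [show 2 * k + 1 + 1 = 2 * (k + 1) by ring, show 2 * k + 1 - 1 = 2 * k by ring] at ha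
        rw [show 2 * k - 1 + 1 = 2 * k by ring, show 2 * k - 1 - 1 = 2 * (k - 1) by ring] at hb
        linarith)
    norm_num at this ⊢
    linarith
  · norm_num; linarith
  · norm_num; linarith
  · norm_num; linarith
  · have := const_of_periodic_of_recurrence_two hm hper hc
    norm_num
    linarith

/-! ### Sorting directions by angle -/

lemma exists_sorted_directions {m : ℕ} (hm : 0 < m) (s : Fin m → Fin 2 → ℤ)
    (hs0 : ∀ i, s i ≠ 0) (hs : ∀ i j, i ≠ j → cross (s i) (s j) ≠ 0) :
    ∃ S : ℤ → Fin 2 → ℤ, (∀ k, S (k + m) = -S k) ∧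
      (∀ i j : ℤ, i < j → j < i + m → 0 < cross (S i) (S j)) ∧
      ∀ k, ∃ i, S k = s i ∨ S k = -s i := by
  obtain ⟨N, hN⟩ : ∃ N : ℤ, ∀ i, s i 0 + N * s i 1 ≠ 0 := by
    have hfin : (⋃ i, {N : ℤ | s i 0 + N * s i 1 = 0}).Finite := by
      refine Set.finite_iUnion fun i => Set.Subsingleton.finite ?_
      intro a ha b hb
      simp only [Set.mem_ofPred_eq] at ha hb
      have hmul : (a - b) * s i 1 = 0 := by linear_combination ha - hb
      rcases mul_eq_zero.1 hmul with h | h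
      · omega
      · exfalso
        apply hs0 i
        ext x
        fin_cases x
        · simpa [h] using ha
        · simpa using h
    obtain ⟨N, hN⟩ := hfin.exists_notMem
    exact ⟨N, fun i hi => hN (Set.mem_iUnion.2 ⟨i, hi⟩)⟩
  have hpos : ∀ i, ∃ v : Fin 2 → ℤ, (v = s i ∨ v = -s i) ∧ 0 < v 0 + N * v 1 := by
    intro i
    rcases lt_or_gt_of_ne (hN i) with h | h
    · refine ⟨-s i, Or.inr rfl, ?_⟩
      simp only [Pi.neg_apply]
      linarith
    · exact ⟨s i, Or.inl rfl, h⟩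
  choose v hv hvpos using hpos
  have hvc : ∀ i j, i ≠ j → cross (v i) (v j) ≠ 0 := by
    intro i j hij
    have := hs i j hij
    rcases hv i with h | h <;> rcases hv j with h' | h' <;>
      rw [h, h'] <;> simpa [cross_neg_left, cross_neg_right] using this
  have hkey : ∀ i j, (v i 1 : ℚ) / (v i 0 + N * v i 1 : ℤ) ≤ v j 1 / (v j 0 + N * v j 1 : ℤ) ↔
      0 ≤ cross (v i) (v j) := by
    intro i j
    rw [div_le_div_iff₀ (by exact_mod_cast hvpos i) (by exact_mod_cast hvpos j)]
    norm_cast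
    rw [← sub_nonneg]
    have : v j 1 * (v i 0 + N * v i 1) - v i 1 * (v j 0 + N * v j 1) = cross (v i) (v j) := by
      simp only [cross]; ring
    rw [this]
  obtain ⟨σ, hσ⟩ : ∃ σ : Equiv.Perm (Fin m), Monotone
      ((fun i => (v i 1 : ℚ) / (v i 0 + N * v i 1 : ℤ)) ∘ σ) := ⟨_, Tuple.monotone_sort _⟩
  set b : Fin m → Fin 2 → ℤ := fun i => v (σ i) with hb
  have hbpos : ∀ i j, i < j → 0 < cross (b i) (b j) := by
    intro i j hij
    have h1 := (hkey _ _).1 (hσ hij.le)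
    have h2 := hvc (σ i) (σ j) (fun h => hij.ne (σ.injective h))
    exact lt_of_le_of_ne h1 h2.symm
  have hm' : (0 : ℤ) < m := by exact_mod_cast hm
  have hlt : ∀ k : ℤ, (k % m).toNat < m := fun k => by
    have := Int.emod_nonneg k hm'.ne'
    have := Int.emod_lt_of_pos k hm'
    omega
  have hadd : ∀ k : ℤ, (k + m) / m = k / m + 1 := fun k => by
    rw [Int.add_ediv_of_dvd_right (dvd_refl _), Int.ediv_self hm'.ne']
  let S : ℤ → Fin 2 → ℤ := fun k => ((k / m).negOnePow : ℤ) • b ⟨(k % m).toNat, hlt k⟩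
  have hSadd : ∀ k, S (k + m) = -S k := by
    intro k
    simp only [S, hadd, Int.negOnePow_succ, Int.add_emod_right]
    simp
  have hrange : ∀ k, ∃ i, S k = b i ∨ S k = -b i := by
    intro k
    refine ⟨⟨(k % m).toNat, hlt k⟩, ?_⟩
    rcases Int.even_or_odd (k / m) with h | h
    · left; simp only [S, Int.negOnePow_even _ h, Units.val_one, one_smul]
    · right; simp only [S, Int.negOnePow_odd _ h, Units.val_neg, Units.val_one, neg_smul, one_smul]
  have hsame : ∀ i j : ℤ, i / m = j / m → i < j → 0 < cross (S i) (S j) := by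
    intro i j hdiv hij
    have hi := Int.emod_add_mul_ediv i m
    have hj := Int.emod_add_mul_ediv j m
    have hi0 := Int.emod_nonneg i hm'.ne'
    rw [hdiv] at hi
    have hlt' : (⟨(i % m).toNat, hlt i⟩ : Fin m) < ⟨(j % m).toNat, hlt j⟩ := by
      rw [Fin.mk_lt_mk]; omega
    have := hbpos _ _ hlt'
    rcases Int.even_or_odd (j / m) with h | h
    · simpa only [S, hdiv, Int.negOnePow_even _ h, Units.val_one, one_smul] using this
    · simpa only [S, hdiv, Int.negOnePow_odd _ h, Units.val_neg, Units.val_one, neg_smul,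
        one_smul, cross_neg_left, cross_neg_right, neg_neg] using this
  refine ⟨S, hSadd, ?_, ?_⟩
  · intro i j hij hji
    have hle1 : i / m ≤ j / m := Int.ediv_le_ediv hm' hij.le
    have hle2 : j / m ≤ i / m + 1 := by
      rw [← hadd]; exact Int.ediv_le_ediv hm' hji.le
    rcases hle1.eq_or_lt with h | h
    · exact hsame i j h hij
    · have := hsame j (i + m) (by rw [hadd]; omega) hji
      rw [hSadd, cross_neg_right, ← cross_swap] at this
      exact this
  · intro k
    obtain ⟨i, hi⟩ := hrange k
    refine ⟨σ i, ?_⟩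
    simp only [hb] at hi
    rcases hi with h | h <;> rcases hv (σ i) with h' | h' <;> rw [h, h'] <;> simp

/-! ### The edge sequence of the convex hull -/

/-- Let `U` be a set of at most `2 m` points such that each point of `U` has a companion in `U`
in each of the `m` directions `S k`. Then `U` is the vertex set of a convex `2 m`-gon, whose
vertices `P k` are listed here in counterclockwise order. -/
lemma exists_polygon {m : ℕ} (hm : 2 ≤ m) {S : ℤ → Fin 2 → ℤ} (hneg : ∀ k, S (k + m) = -S k)
    (hpos : ∀ i j : ℤ, i < j → j < i + m → 0 < cross (S i) (S j))
    {U : Finset (Fin 2 → ℤ)} (hU : U.Nonempty) (hcard : U.card ≤ 2 * m)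
    (hmate : ∀ k, ∀ x ∈ U, ∃ y ∈ U, y ≠ x ∧ cross (S k) (y - x) = 0) :
    ∃ P : ℤ → Fin 2 → ℤ, (∀ k, P (k + 2 * m) = P k) ∧ (∀ k, P k ∈ U) ∧
      (∀ x ∈ U, ∃ k, P k = x) ∧
      (∀ k z, ∃ p q : ℤ, 0 < p ∧ 0 < q ∧
        p * cross (P k - P (k - 1)) z = q * cross (S k) z) := by
  have hm2 : (2 : ℤ) ≤ m := by exact_mod_cast hm
  have hS0 : ∀ k, S k ≠ 0 := fun k h => by
    have := hpos k (k + 1) (by omega) (by omega)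
    simp [h, cross] at this
  have hSper : ∀ k, S (k + 2 * m) = S k := fun k => by
    rw [two_mul, ← add_assoc, hneg, hneg, neg_neg]
  have hSneg : ∀ i j : ℤ, i + m < j → j < i + 2 * m → cross (S i) (S j) < 0 := fun i j h1 h2 => by
    have := hpos i (j - m) (by omega) (by omega)
    have h3 := hneg (j - m)
    rw [sub_add_cancel] at h3
    rw [h3, cross_neg_right]
    omega
  have hopp : ∀ i j : ℤ, i < j → j < i + 2 * m → cross (S i) (S j) = 0 → j = i + m :=
    fun i j h1 h2 h => by
      rcases lt_trichotomy j (i + m) with h3 | h3 | h3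
      · exact absurd h (hpos i j h1 h3).ne'
      · exact h3
      · exact absurd h (hSneg i j h3 h2).ne
  have hspan : ∀ k, ∀ x ∈ U, ∃ y ∈ U, cross (S k) (y - x) ≠ 0 := fun k x hx => by
    obtain ⟨y, hy, hyx, hc⟩ := hmate (k + 1) x hx
    refine ⟨y, hy, fun h => hyx (sub_eq_zero.1 ?_)⟩
    exact eq_zero_of_cross_eq_zero (hpos k (k + 1) (by omega) (by omega)).ne' h hc
  have hedge : ∀ v, (∃ k, S k = v) → ∃ h t, h ∈ U ∧ t ∈ U ∧ 0 < dot v (h - t) ∧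
      cross v (h - t) = 0 ∧ ∀ x ∈ U, 0 ≤ cross v (x - h) := by
    rintro v ⟨k, rfl⟩
    obtain ⟨x, hx, hmin⟩ := Finset.exists_min_image U (cross (S k)) hU
    obtain ⟨y, hy, hyx, hc⟩ := hmate k x hx
    have hd := dot_ne_zero hc (hS0 k) (sub_ne_zero.2 hyx)
    rcases lt_or_gt_of_ne hd with hlt | hgt
    · refine ⟨x, y, hx, hy, ?_, ?_, fun z hz => ?_⟩
      · simp only [dot, Pi.sub_apply] at *; linarith
      · simp only [cross, Pi.sub_apply] at *; linarith
      · rw [cross_sub_right]; linarith [hmin z hz]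
    · refine ⟨y, x, hy, hx, hgt, hc, fun z hz => ?_⟩
      rw [cross_sub_right] at *; linarith [hmin z hz]
  choose! H T hHU hTU hdot hpar hmin using hedge
  have hPU : ∀ k, H (S k) ∈ U := fun k => hHU _ ⟨k, rfl⟩
  have hQU : ∀ k, T (S k) ∈ U := fun k => hTU _ ⟨k, rfl⟩
  have hPmin : ∀ k, ∀ x ∈ U, 0 ≤ cross (S k) (x - H (S k)) := fun k => hmin _ ⟨k, rfl⟩
  have hQmin : ∀ k, ∀ x ∈ U, 0 ≤ cross (S k) (x - T (S k)) := fun k x hx => by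
    have h1 := hPmin k x hx
    have h2 := hpar _ ⟨k, rfl⟩
    rw [cross_sub_right] at *; linarith
  have hscale : ∀ k z, dot (S k) (S k) * cross (H (S k) - T (S k)) z =
      dot (S k) (H (S k) - T (S k)) * cross (S k) z := fun k z =>
    dot_mul_cross (hpar _ ⟨k, rfl⟩) z
  have hsign : ∀ k z, 0 ≤ cross (H (S k) - T (S k)) z → 0 ≤ cross (S k) z := fun k z h => by
    have h1 := mul_nonneg (dot_self_pos (hS0 k)).le h
    rw [hscale] at h1
    exact nonneg_of_mul_nonneg_right h1 (hdot _ ⟨k, rfl⟩)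
  have hPQ : ∀ k, H (S k) ≠ T (S k) := fun k h => by
    have := hdot _ ⟨k, rfl⟩
    simp [h, dot] at this
  have hnot_opp : ∀ k, ∀ x ∈ U, (∀ y ∈ U, 0 ≤ cross (S k) (y - x)) →
      ¬ ∀ y ∈ U, 0 ≤ cross (S (k + m)) (y - x) := fun k x hx h1 h2 => by
    obtain ⟨y, hy, hne⟩ := hspan k x hx
    have h3 := h1 y hy
    have h4 := h2 y hy
    rw [hneg, cross_neg_left] at h4
    exact hne (by omega)
  have hPsign : ∀ i j, (∀ y ∈ U, 0 ≤ cross (S j) (y - H (S i))) → 0 ≤ cross (S i) (S j) :=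
    fun i j h => by
      apply hsign
      have := h _ (hQU i)
      rw [cross_swap, ← cross_neg_right, neg_sub]
      exact this
  have hQsign : ∀ i j, (∀ y ∈ U, 0 ≤ cross (S j) (y - T (S i))) → 0 ≤ cross (S i) (-S j) :=
    fun i j h => by
      apply hsign
      have := h _ (hPU i)
      rw [cross_neg_right, ← cross_swap]
      exact this
  have hPinj : ∀ i j : ℤ, i < j → j < i + 2 * m → H (S i) ≠ H (S j) := fun i j h1 h2 heq => by
    have ha := hPsign i j (heq ▸ hPmin j)
    have hb := hPsign j i (heq ▸ hPmin i)
    rw [cross_swap] at hb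
    obtain rfl := hopp i j h1 h2 (by omega)
    exact hnot_opp i _ (hPU i) (hPmin i) (heq ▸ hPmin (i + m))
  have hQinj : ∀ i j : ℤ, i < j → j < i + 2 * m → T (S i) ≠ T (S j) := fun i j h1 h2 heq => by
    have ha := hQsign i j (heq ▸ hQmin j)
    have hb := hQsign j i (heq ▸ hQmin i)
    rw [cross_neg_right] at ha hb
    rw [cross_swap] at hb
    obtain rfl := hopp i j h1 h2 (by omega)
    exact hnot_opp i _ (hQU i) (hQmin i) (heq ▸ hQmin (i + m))
  have hsurj : ∀ f : ℤ → Fin 2 → ℤ, (∀ k, f k ∈ U) →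
      (∀ i j : ℤ, i < j → j < i + 2 * m → f i ≠ f j) → ∀ k : ℤ, ∀ x ∈ U,
      ∃ j, k ≤ j ∧ j < k + 2 * m ∧ f j = x := by
    intro f hfU hfinj k x hx
    have himg : (Finset.Ico k (k + 2 * m)).image f = U := by
      apply Finset.eq_of_subset_of_card_le
      · intro y hy
        obtain ⟨j, -, rfl⟩ := Finset.mem_image.1 hy
        exact hfU j
      · rw [Finset.card_image_of_injOn]
        · simp only [Int.card_Ico]; omega
        · intro i hi j hj hij
          simp only [Finset.coe_Ico, Set.mem_Ico] at hi hj
          by_contra hne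
          rcases lt_or_gt_of_ne hne with h | h
          · exact hfinj i j h (by omega) hij
          · exact hfinj j i h (by omega) hij.symm
    rw [← himg] at hx
    obtain ⟨j, hj, rfl⟩ := Finset.mem_image.1 hx
    rw [Finset.mem_Ico] at hj
    exact ⟨j, hj.1, hj.2, rfl⟩
  have hnext : ∀ k, T (S (k + 1)) = H (S k) := by
    intro k
    obtain ⟨j, hj1, hj2, hj⟩ := hsurj (fun k => T (S k)) hQU hQinj k _ (hPU k)
    have hjmin : ∀ y ∈ U, 0 ≤ cross (S j) (y - H (S k)) := hj ▸ hQmin j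
    have hjk := hPsign k j hjmin
    have hj3 : k < j := by
      rcases hj1.eq_or_lt with rfl | h
      · exact absurd hj.symm (hPQ k)
      · exact h
    have hj4 : j < k + m := by
      rcases lt_trichotomy j (k + m) with h | rfl | h
      · exact h
      · exact absurd hjmin (hnot_opp k _ (hPU k) (hPmin k))
      · have := hSneg k j h hj2
        omega
    by_cases hj5 : j = k + 1
    · rw [← hj5, hj]
    exfalso
    obtain ⟨z, hz, hzx, hzmin⟩ : ∃ z ∈ U, z ≠ H (S k) ∧
        ∀ y ∈ U, 0 ≤ cross (S (k + 1)) (y - z) := by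
      by_cases h : H (S (k + 1)) = H (S k)
      · exact ⟨_, hQU (k + 1), fun h' => hPQ (k + 1) (h.trans h'.symm), hQmin _⟩
      · exact ⟨_, hPU (k + 1), h, hPmin _⟩
    have h1 := hPmin k z hz
    have h2 := hjmin z hz
    have h3 : cross (S (k + 1)) (z - H (S k)) ≤ 0 := by
      have := hzmin _ (hPU k)
      rw [← neg_sub, cross_neg_right] at this
      omega
    have hkj := hpos k j hj3 hj4
    have hk1 := hpos k (k + 1) (by omega) (by omega)
    have h1j := hpos (k + 1) j (by omega) (by omega)
    have hid : cross (S k) (S j) * cross (S (k + 1)) (z - H (S k)) =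
        cross (S (k + 1)) (S j) * cross (S k) (z - H (S k)) +
        cross (S k) (S (k + 1)) * cross (S j) (z - H (S k)) := by
      simp only [cross]; ring
    have h4 := mul_nonpos_of_nonneg_of_nonpos hkj.le h3
    have h5 := mul_nonneg h1j.le h1
    have h6 := mul_nonneg hk1.le h2
    have h7 : cross (S k) (z - H (S k)) = 0 :=
      (mul_eq_zero.1 (show cross (S (k + 1)) (S j) * cross (S k) (z - H (S k)) = 0
        by linarith)).resolve_left h1j.ne'
    have h8 : cross (S j) (z - H (S k)) = 0 :=
      (mul_eq_zero.1 (show cross (S k) (S (k + 1)) * cross (S j) (z - H (S k)) = 0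
        by linarith)).resolve_left hk1.ne'
    exact hzx (sub_eq_zero.1 (eq_zero_of_cross_eq_zero hkj.ne' h7 h8))
  refine ⟨fun k => H (S k), fun k => by simp only [hSper], hPU, fun x hx => ?_, fun k z => ?_⟩
  · obtain ⟨j, -, -, hj⟩ := hsurj (fun k => H (S k)) hPU hPinj 0 x hx
    exact ⟨j, hj⟩
  · refine ⟨_, _, dot_self_pos (hS0 k), hdot _ ⟨k, rfl⟩, ?_⟩
    have := hnext (k - 1)
    rw [sub_add_cancel] at this
    simp only [← this]
    exact hscale k z

/-- In a convex `2 m`-gon `P` in which each vertex has a companion in the direction of each edge,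
the chords joining `P (i + r)` and `P (i - 1 - r)` are parallel to the edge from `P (i - 1)` to
`P i`. -/
lemma cross_chord_eq {m : ℕ} {P : ℤ → Fin 2 → ℤ} (hper : ∀ k, P (k + 2 * m) = P k)
    (hpos : ∀ i j : ℤ, i < j → j < i + m → 0 < cross (P i - P (i - 1)) (P j - P (j - 1)))
    (hmate : ∀ i k, ∃ j, P j ≠ P k ∧ cross (P i - P (i - 1)) (P j - P k) = 0)
    (i : ℤ) (r : ℕ) (hr : r < m) :
    cross (P i - P (i - 1)) (P (i + r)) = cross (P i - P (i - 1)) (P (i - 1 - r)) := by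
  have hm' : (0 : ℤ) < m := by exact_mod_cast (Nat.zero_le r).trans_lt hr
  set f := fun k => cross (P i - P (i - 1)) (P k) with hf
  have hup : ∀ a b : Fin m, a < b → f (i + a) < f (i + b) := by
    suffices h : ∀ n a : ℕ, a + n + 1 < m → f (i + a) < f (i + (a + n + 1 : ℕ)) by
      intro a b hab
      have hab' : (a : ℕ) < b := hab
      have := h (b - a - 1) a (by omega)
      rwa [show (a : ℕ) + (b - a - 1) + 1 = b by omega] at this
    have hstep : ∀ a : ℕ, a + 1 < m → f (i + a) < f (i + (a + 1 : ℕ)) := fun a ha => by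
      have := hpos i (i + (a + 1 : ℕ)) (by push_cast; omega) (by push_cast; omega)
      rw [cross_sub_right, show i + ((a + 1 : ℕ) : ℤ) - 1 = i + a by push_cast; ring] at this
      simp only [hf]; linarith
    intro n
    induction n with
    | zero => intro a ha; exact hstep a ha
    | succ n ih =>
      intro a ha
      exact (ih a (by omega)).trans (hstep (a + n + 1) (by omega))
  have hdown : ∀ a b : Fin m, a < b → f (i - 1 - a) < f (i - 1 - b) := by
    suffices h : ∀ n a : ℕ, a + n + 1 < m → f (i - 1 - a) < f (i - 1 - (a + n + 1 : ℕ)) by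
      intro a b hab
      have hab' : (a : ℕ) < b := hab
      have := h (b - a - 1) a (by omega)
      rwa [show (a : ℕ) + (b - a - 1) + 1 = b by omega] at this
    have hstep : ∀ a : ℕ, a + 1 < m → f (i - 1 - a) < f (i - 1 - (a + 1 : ℕ)) := fun a ha => by
      have := hpos (i - 1 - a) i (by omega) (by omega)
      rw [cross_swap, cross_sub_right,
        show i - 1 - (a : ℤ) - 1 = i - 1 - (a + 1 : ℕ) by push_cast; ring] at this
      simp only [hf]; linarith
    intro n
    induction n with
    | zero => intro a ha; exact hstep a ha
    | succ n ih =>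
      intro a ha
      exact (ih a (by omega)).trans (hstep (a + n + 1) (by omega))
  have hcover : ∀ k, ∃ a : Fin m, P k = P (i + a) ∨ P k = P (i - 1 - a) := by
    intro k
    have hp : Function.Periodic P (2 * m : ℤ) := hper
    have h1 := hp.sub_int_mul_eq (x := k) ((k - (i - m)) / (2 * m))
    have h2 := Int.emod_add_mul_ediv (k - (i - m)) (2 * m)
    have h3 := Int.emod_nonneg (k - (i - m)) (by omega : (2 * m : ℤ) ≠ 0)
    have h4 := Int.emod_lt_of_pos (k - (i - m)) (by omega : (0 : ℤ) < 2 * m)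
    set ρ := (k - (i - m)) % (2 * m)
    have h5 : k - ((k - (i - m)) / (2 * m) : ℤ) * (2 * m) = i - m + ρ := by linarith
    simp only [Int.cast_id] at h1
    rw [h5] at h1
    by_cases h : ρ < m
    · refine ⟨⟨(m - 1 - ρ).toNat, by omega⟩, Or.inr ?_⟩
      rw [← h1]; congr 1; simp only; omega
    · refine ⟨⟨(ρ - m).toNat, by omega⟩, Or.inl ?_⟩
      rw [← h1]; congr 1; simp only; omega
  have hu : StrictMono fun a : Fin m => f (i + a) := fun a b => hup a b
  have hw : StrictMono fun a : Fin m => f (i - 1 - a) := fun a b => hdown a b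
  have hrange : Set.range (fun a : Fin m => f (i + a)) =
      Set.range (fun a : Fin m => f (i - 1 - a)) := by
    apply Set.Subset.antisymm
    · rintro _ ⟨a, rfl⟩
      obtain ⟨j, hne, hj⟩ := hmate i (i + a)
      rw [cross_sub_right, sub_eq_zero] at hj
      obtain ⟨b, hb | hb⟩ := hcover j
      · rw [hb] at hj hne
        exact absurd (by rw [hu.injective hj]) hne
      · exact ⟨b, by rw [hb] at hj; exact hj⟩
    · rintro _ ⟨a, rfl⟩
      obtain ⟨j, hne, hj⟩ := hmate i (i - 1 - a)
      rw [cross_sub_right, sub_eq_zero] at hj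
      obtain ⟨b, hb | hb⟩ := hcover j
      · exact ⟨b, by rw [hb] at hj; exact hj⟩
      · rw [hb] at hj hne
        exact absurd (by rw [hw.injective hj]) hne
  exact congrFun ((hu.range_inj hw).1 hrange) ⟨r, hr⟩

/-- No lattice sequence of edges `e` turning by less than a straight angle, closing up after
`2 m` steps, has `e (i + r) + e (i - r)` parallel to `e i` for `r = 1` and `r = 2`, if `m = 5` or
`m > 6`. -/
lemma false_of_symmetric_edges {m : ℕ} (hm : m = 5 ∨ 6 < m) {e : ℤ → Fin 2 → ℤ}
    (hper : ∀ k, e (k + 2 * m) = e k)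
    (hpos : ∀ i j : ℤ, i < j → j < i + m → 0 < cross (e i) (e j))
    (h1 : ∀ i, cross (e i) (e (i + 1) + e (i - 1)) = 0)
    (h2 : ∀ i, cross (e i) (e (i + 2) + e (i - 2)) = 0) : False := by
  have hD : ∀ i, cross (e i) (e (i + 1)) = cross (e 0) (e 1) := by
    intro i
    have hp : Function.Periodic (fun i => cross (e i) (e (i + 1))) 1 := fun i => by
      have := h1 (i + 1)
      rw [cross_add_right, add_sub_cancel_right, cross_swap _ (e i)] at this
      simp only; linarith
    have := hp.int_mul_eq i
    simpa using this
  have hE : ∀ i, cross (e i) (e (i + 2)) = cross (e (i - 2)) (e i) := fun i => by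
    have := h2 i
    rw [cross_add_right, cross_swap _ (e (i - 2))] at this
    linarith
  set D := cross (e 0) (e 1) with hDdef
  have hDpos : 0 < D := hpos 0 1 (by omega) (by omega)
  set E := fun i => cross (e i) (e (i + 2)) with hEdef
  have hEE : ∀ i, E i * E (i - 1) = E 0 * E (-1) := by
    intro i
    have hp : Function.Periodic (fun i => E i * E (i - 1)) 1 := fun i => by
      have := hE (i + 1)
      rw [show i + 1 - 2 = i - 1 by ring] at this
      have h3 : E (i + 1) = E (i - 1) := by
        simp only [hEdef]
        rw [this]; congr 2; ring
      simp only [add_sub_cancel_right]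
      rw [h3, mul_comm]
    have := hp.int_mul_eq i
    simpa using this
  have hrec1 : ∀ i a, D * (e (i + 1) a + e (i - 1) a) = E (i - 1) * e i a := by
    intro i a
    have ha := hD i
    have hb := hD (i - 1)
    rw [sub_add_cancel] at hb
    have hc : E (i - 1) = cross (e (i - 1)) (e (i + 1)) := by
      simp only [hEdef]; congr 2; ring
    rw [hc]
    simp only [cross] at *
    fin_cases a <;> simp only [Fin.zero_eta, Fin.mk_one]
    · linear_combination (-e (i - 1) 0) * ha - (e (i + 1) 0) * hb
    · linear_combination (-e (i - 1) 1) * ha - (e (i + 1) 1) * hb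
  have hrec2 : ∀ i a, D ^ 2 * (e (i + 2) a + e (i - 2) a) =
      (E 0 * E (-1) - 2 * D ^ 2) * e i a := by
    intro i a
    have ha := hrec1 (i + 1) a
    have hb := hrec1 (i - 1) a
    have hc := hrec1 i a
    have hd : E (i - 1 - 1) = E i := by
      have := hE i
      simp only [hEdef]
      rw [this]; congr 2 <;> ring
    rw [add_sub_cancel_right, show i + 1 + 1 = i + 2 by ring] at ha
    rw [sub_add_cancel, hd, show i - 1 - 1 = i - 2 by ring] at hb
    rw [← hEE i]
    linear_combination D * ha + D * hb + E i * hc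
  set c := fun a k => e (2 * k) a with hcdef
  have hcrec : ∀ a k, D ^ 2 * (c a (k + 1) + c a (k - 1)) =
      (E 0 * E (-1) - 2 * D ^ 2) * c a k := by
    intro a k
    have := hrec2 (2 * k) a
    simp only [hcdef]
    rwa [show 2 * (k + 1) = 2 * k + 2 by ring, show 2 * (k - 1) = 2 * k - 2 by ring]
  have hcper : ∀ a k, c a (k + m) = c a k := fun a k => by
    simp only [hcdef, mul_add, hper]
  have hm0 : 0 < m := by omega
  have hD2 : 0 < D ^ 2 := by positivity
  obtain ⟨a₀, ha₀⟩ : ∃ a, c a 0 ≠ 0 := by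
    by_contra! h
    have h0 := h 0
    have h1 := h 1
    simp only [hcdef, mul_zero] at h0 h1
    simp [hDdef, cross, h0, h1] at hDpos
  obtain ⟨t, ht⟩ := dvd_of_recurrence hD2 (hcrec a₀) ha₀
  have hct : ∀ a k, c a (k + 1) + c a (k - 1) = t * c a k := fun a k => by
    apply mul_left_cancel₀ hD2.ne'
    rw [hcrec, ht, mul_assoc]
  have htle := abs_le_two_of_recurrence hm0 (hcper a₀) (hct a₀) ha₀
  have hne : ∀ r : ℤ, 0 < r → r < 2 * m → e r ≠ e 0 := by
    intro r hr0 hr heq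
    rcases lt_trichotomy r m with h | h | h
    · have := hpos 0 r hr0 (by omega)
      rw [heq] at this
      simp [cross, mul_comm] at this
    · have h3 := hpos 1 r (by omega) (by omega)
      rw [heq, cross_swap] at h3
      omega
    · have := hpos r (0 + 2 * m) (by omega) (by omega)
      rw [hper, heq] at this
      simp [cross, mul_comm] at this
  have hfinal : e 8 = e 0 ∨ e 12 = e 0 := by
    by_cases h : |t| = 1
    · right
      ext a
      simpa [hcdef] using (apply_eq_apply_zero_of_recurrence hm0 htle (hcper a) (hct a)).2 h
    · left
      ext a
      simpa [hcdef] using (apply_eq_apply_zero_of_recurrence hm0 htle (hcper a) (hct a)).1 h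
  rcases hfinal with h | h
  · exact hne 8 (by omega) (by omega) h
  · rcases hm with rfl | hm
    · have := hper 2
      norm_num at this
      exact hne 2 (by omega) (by norm_num) (this.symm.trans h)
    · exact hne 12 (by omega) (by omega) h

/-- If each point of a nonempty finite set `U` has a companion in `U` in each of `m` directions,
then `U` has more than `2 m` points, for `m = 5` or `m > 6`. -/
lemma two_mul_lt_card_of_companions {m : ℕ} (hm : m = 5 ∨ 6 < m) (s : Fin m → Fin 2 → ℤ)
    (hs0 : ∀ i, s i ≠ 0) (hs : ∀ i j, i ≠ j → cross (s i) (s j) ≠ 0)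
    {U : Finset (Fin 2 → ℤ)} (hU : U.Nonempty)
    (hmate : ∀ i, ∀ x ∈ U, ∃ y ∈ U, y ≠ x ∧ cross (s i) (y - x) = 0) : 2 * m < U.card := by
  by_contra! hcard
  obtain ⟨S, hneg, hpos, hrange⟩ := exists_sorted_directions (by omega) s hs0 hs
  have hmate' : ∀ k, ∀ x ∈ U, ∃ y ∈ U, y ≠ x ∧ cross (S k) (y - x) = 0 := by
    intro k x hx
    obtain ⟨i, hi⟩ := hrange k
    obtain ⟨y, hy, hyx, hc⟩ := hmate i x hx
    refine ⟨y, hy, hyx, ?_⟩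
    rcases hi with h | h <;> simp [h, cross_neg_left, hc]
  obtain ⟨P, hper, hPU, hsurj, hscale⟩ :=
    exists_polygon (by omega) hneg hpos hU hcard hmate'
  have hPpos : ∀ i j : ℤ, i < j → j < i + m →
      0 < cross (P i - P (i - 1)) (P j - P (j - 1)) := by
    intro i j hij hji
    obtain ⟨p, q, hp, hq, h⟩ := hscale i (P j - P (j - 1))
    obtain ⟨p', q', hp', hq', h'⟩ := hscale j (S i)
    rw [cross_swap, cross_swap (S j)] at h'
    have h1 : 0 < q' * cross (S i) (S j) := mul_pos hq' (hpos i j hij hji)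
    have h2 : 0 < p' * cross (S i) (P j - P (j - 1)) := by linarith
    have h3 := mul_pos hq (pos_of_mul_pos_right h2 hp'.le)
    rw [← h] at h3
    exact pos_of_mul_pos_right h3 hp.le
  have hPmate : ∀ i k, ∃ j, P j ≠ P k ∧ cross (P i - P (i - 1)) (P j - P k) = 0 := by
    intro i k
    obtain ⟨y, hy, hyx, hc⟩ := hmate' i _ (hPU k)
    obtain ⟨j, rfl⟩ := hsurj y hy
    obtain ⟨p, q, hp, -, h⟩ := hscale i (P j - P k)
    rw [hc, mul_zero] at h
    exact ⟨j, hyx, (mul_eq_zero.1 h).resolve_left hp.ne'⟩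
  have hchord := cross_chord_eq hper hPpos hPmate
  refine false_of_symmetric_edges hm (e := fun k => P k - P (k - 1)) (fun k => ?_) hPpos
    (fun i => ?_) (fun i => ?_)
  · simp only [hper, add_sub_right_comm]
  · have h0 := hchord i 0 (by omega)
    have h1 := hchord i 1 (by omega)
    simp only [Nat.cast_zero, Nat.cast_one, add_zero, sub_zero] at h0 h1
    simp only [add_sub_cancel_right, cross_add_right, cross_sub_right (P i - P (i - 1))]
    linarith
  · have h1 := hchord i 1 (by omega)
    have h2 := hchord i 2 (by omega)
    simp only [Nat.cast_one, Nat.cast_ofNat] at h1 h2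
    rw [show i - 1 - 1 = i - 2 by ring] at h1
    rw [show i - 1 - 2 = i - 2 - 1 by ring] at h2
    simp only [show i + 2 - 1 = i + 1 by ring, cross_add_right,
      cross_sub_right (P i - P (i - 1))]
    linarith

/-! ### Equal X-rays -/

lemma EqualXraysZ.symm {d : ℕ} {F F' : Set (Fin d → ℤ)} {s : Fin d → ℤ}
    (h : EqualXraysZ F F' s) : EqualXraysZ F' F s := fun p => (h p).symm

lemma EqualXraysZ.exists_companion {F F' : Set (Fin 2 → ℤ)} {s : Fin 2 → ℤ} (hF : F.Finite)
    (h : EqualXraysZ F F' s) {x : Fin 2 → ℤ} (hx : x ∈ F \ F') :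
    ∃ y ∈ F' \ F, y ≠ x ∧ cross s (y - x) = 0 := by
  by_contra! hno
  have hline : ∀ y, castVec y ∈ lineThrough (castVec x) (castVec s) → cross s (y - x) = 0 := by
    rintro y ⟨t, ht⟩
    have h0 := congrFun ht 0
    have h1 := congrFun ht 1
    simp only [castVec, Pi.add_apply, Pi.smul_apply, smul_eq_mul] at h0 h1
    have : ((cross s (y - x) : ℤ) : ℝ) = 0 := by
      simp only [cross, Pi.sub_apply]
      push_cast
      rw [h0, h1]; ring
    exact_mod_cast this
  have hss : {y ∈ F' | castVec y ∈ lineThrough (castVec x) (castVec s)} ⊂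
      {y ∈ F | castVec y ∈ lineThrough (castVec x) (castVec s)} := by
    refine (Set.ssubset_iff_of_subset ?_).2 ⟨x, ⟨hx.1, 0, by simp⟩, fun hc => hx.2 hc.1⟩
    rintro y ⟨hy, hyL⟩
    refine ⟨?_, hyL⟩
    by_contra hyF
    exact hno y ⟨hy, hyF⟩ (fun hyx => hyF (hyx ▸ hx.1)) (hline y hyL)
  exact (Set.ncard_lt_ncard hss (hF.subset (Set.sep_subset _ _))).ne' (h (castVec x))

lemma PairwiseLinIndepZ.cross_ne_zero {m : ℕ} {s : Fin m → Fin 2 → ℤ}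
    (h : PairwiseLinIndepZ s) (hs0 : ∀ i, s i ≠ 0) {i j : Fin m} (hij : i ≠ j) :
    cross (s i) (s j) ≠ 0 := by
  intro hc
  have hp : (dot (s j) (s j) : ℝ) ≠ 0 := by exact_mod_cast (dot_self_pos (hs0 j)).ne'
  apply h i j hij (dot (s i) (s j) / dot (s j) (s j))
  have hc' : (cross (s i) (s j) : ℝ) = 0 := by exact_mod_cast hc
  ext a
  simp only [castVec, Pi.smul_apply, smul_eq_mul]
  rw [div_mul_eq_mul_div, eq_div_iff hp]
  simp only [dot, cross] at *
  push_cast at *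
  fin_cases a <;> simp only [Fin.zero_eta, Fin.mk_one]
  · linear_combination (s j 1 : ℝ) * hc'
  · linear_combination (-s j 0 : ℝ) * hc'

/-- **Theorem 2:** `ψ_{ℤ²}(m) ≥ m + 1` for `m = 5` or `m > 6`. -/
theorem psi_Z2_ge_succ (m n : ℕ) (hm : m = 5 ∨ 6 < m) (F F' : Set (Fin 2 → ℤ))
    (hF : F.Finite) (hF' : F'.Finite) (hne : F ≠ F')
    (hFn : F.ncard = n) (hF'n : F'.ncard = n)
    (s : Fin m → (Fin 2 → ℤ)) (hs0 : ∀ i, s i ≠ 0)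
    (hind : PairwiseLinIndepZ s)
    (hxray : ∀ i, EqualXraysZ F F' (s i)) : m + 1 ≤ n := by
  have hfin : ((F \ F') ∪ (F' \ F)).Finite := hF.sdiff.union hF'.sdiff
  have hne' : hfin.toFinset.Nonempty := by
    rw [Set.Finite.toFinset_nonempty]
    by_contra h
    rw [Set.not_nonempty_iff_eq_empty, Set.union_empty_iff, Set.sdiff_eq_empty,
      Set.sdiff_eq_empty] at h
    exact hne (h.1.antisymm h.2)
  have hlt := two_mul_lt_card_of_companions hm s hs0
    (fun i j hij => hind.cross_ne_zero hs0 hij) hne' (fun i x hx => by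
      simp only [Set.Finite.mem_toFinset] at hx ⊢
      rcases hx with hx | hx
      · obtain ⟨y, hy, h⟩ := (hxray i).exists_companion hF hx
        exact ⟨y, Or.inr hy, h⟩
      · obtain ⟨y, hy, h⟩ := (hxray i).symm.exists_companion hF' hx
        exact ⟨y, Or.inl hy, h⟩)
  rw [← Set.ncard_eq_toFinset_card _ hfin] at hlt
  have h1 := Set.ncard_union_le (F \ F') (F' \ F)
  have h2 := Set.ncard_le_ncard (Set.sdiff_subset : F \ F' ⊆ F) hF
  have h3 := Set.ncard_le_ncard (Set.sdiff_subset : F' \ F ⊆ F') hF'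
  omega
end

section
/- (Corollary 1: strengthened Rényi theorem in ℤ².) Let n ∈ ℕ with n = 5 or n > 6, and let F ⊆ ℤ² be a set with |F| = n. If F' ⊆ ℤ² is any finite set that has equal X-rays as F in each of m ≥ n pairwise linearly independent nonzero directions s_1, …, s_m ∈ ℤ², then F' = F. That is, any n-point set in ℤ² with n = 5 or n > 6 is uniquely determined by its X-rays taken from at least n different directions. -/
/-- The determinant of two integer vectors in the plane. -/
def planeDet (u v : Fin 2 → ℤ) : ℤ := u 0 * v 1 - u 1 * v 0

lemma eq_zero_of_planeDet_eq_zero {u v w : Fin 2 → ℤ} (huv : planeDet u v ≠ 0)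
    (hu : planeDet u w = 0) (hv : planeDet v w = 0) : w = 0 := by
  simp only [planeDet] at *
  have h0 : (u 0 * v 1 - u 1 * v 0) * w 0 = 0 := by linear_combination v 0 * hu - u 0 * hv
  have h1 : (u 0 * v 1 - u 1 * v 0) * w 1 = 0 := by linear_combination v 1 * hu - u 1 * hv
  funext i
  fin_cases i
  · exact (mul_eq_zero.1 h0).resolve_left huv
  · exact (mul_eq_zero.1 h1).resolve_left huv

/-- `C` is the vertex set of a convex polygon traversed counterclockwise by `nx`, whose vertices
lie alternately in `A` and outside `A`, and such that every line parallel to an edge that meets `C`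
contains exactly one vertex of each kind. -/
structure IsXrayPolygon (C : Finset (Fin 2 → ℤ)) (A : Set (Fin 2 → ℤ))
    (nx : (Fin 2 → ℤ) → (Fin 2 → ℤ)) : Prop where
  mem : ∀ p ∈ C, nx p ∈ C
  color : ∀ p ∈ C, (nx p ∈ A ↔ p ∉ A)
  left : ∀ p ∈ C, ∀ x ∈ C, 0 ≤ planeDet (nx p - p) (x - p)
  eq_or : ∀ p ∈ C, ∀ x ∈ C, planeDet (nx p - p) (x - p) = 0 → x = p ∨ x = nx p
  partner : ∀ p ∈ C, ∀ x ∈ C, ∃ y ∈ C, (y ∈ A ↔ x ∉ A) ∧ planeDet (nx p - p) (y - x) = 0 ∧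
    ∀ z ∈ C, planeDet (nx p - p) (z - x) = 0 → z = x ∨ z = y

namespace IsXrayPolygon

variable {C : Finset (Fin 2 → ℤ)} {A : Set (Fin 2 → ℤ)} {nx : (Fin 2 → ℤ) → (Fin 2 → ℤ)}

lemma next_ne (h : IsXrayPolygon C A nx) {p : Fin 2 → ℤ} (hp : p ∈ C) : nx p ≠ p := by
  intro e
  have := h.color p hp
  rw [e] at this
  tauto

lemma iterate_mem (h : IsXrayPolygon C A nx) {p : Fin 2 → ℤ} (hp : p ∈ C) (k : ℕ) :
    nx^[k] p ∈ C := by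
  induction k with
  | zero => exact hp
  | succ k ih => rw [Function.iterate_succ_apply']; exact h.mem _ ih

lemma next_injOn (h : IsXrayPolygon C A nx) {p q : Fin 2 → ℤ} (hp : p ∈ C) (hq : q ∈ C)
    (e : nx p = nx q) : p = q := by
  have h1 := h.left p hp q hq
  have h2 := h.left q hq p hp
  have h3 : planeDet (nx p - p) (q - p) = 0 := by
    rw [← e] at h2
    simp only [planeDet, Pi.sub_apply] at *
    linarith
  rcases h.eq_or p hp q hq h3 with h4 | h4
  · exact h4.symm
  · exact absurd (h4.trans e).symm (h.next_ne hq)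

/-- A supporting functional of the polygon that has a local minimum along the boundary at `nx a`
attains its global minimum there. -/
lemma eq_or_eq_of_isMin (h : IsXrayPolygon C A nx) {a x : Fin 2 → ℤ} (ha : a ∈ C) (hx : x ∈ C)
    (h1 : planeDet (nx x - x) (nx a - x) ≤ planeDet (nx x - x) (a - x))
    (h2 : planeDet (nx x - x) (nx a - x) ≤ planeDet (nx x - x) (nx (nx a) - x)) :
    x = a ∨ x = nx a ∨ nx x = nx a := by
  have hb := h.mem a ha
  have hc := h.mem _ hb
  have hL := h.left a ha x hx
  have hR := h.left _ hb x hx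
  have hx0 := h.left x hx _ hb
  have hD := h.left a ha _ hc
  rcases hD.eq_or_lt with hD | hD
  · rcases h.eq_or a ha _ hc hD.symm with e | e
    · rw [e] at hR
      have h3 : planeDet (nx a - a) (x - a) = 0 := by
        simp only [planeDet, Pi.sub_apply] at *
        linarith
      rcases h.eq_or a ha x hx h3 with e | e <;> simp [e]
    · exact absurd e (h.next_ne hb)
  · have h3 : planeDet (nx x - x) (nx a - x) = 0 := by
      refine le_antisymm ?_ hx0
      by_contra! hlt
      have e : planeDet (nx a - a) (nx (nx a) - a) * planeDet (nx x - x) (nx a - x) =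
          -(planeDet (nx a - a) (x - a) *
            (planeDet (nx x - x) (nx (nx a) - x) - planeDet (nx x - x) (nx a - x))) -
          planeDet (nx (nx a) - nx a) (x - nx a) *
            (planeDet (nx x - x) (a - x) - planeDet (nx x - x) (nx a - x)) := by
        simp only [planeDet, Pi.sub_apply]
        ring
      have := mul_pos hD hlt
      have := mul_nonneg hL (sub_nonneg.2 h2)
      have := mul_nonneg hR (sub_nonneg.2 h1)
      linarith
    rcases h.eq_or x hx _ hb h3 with e | e
    · exact Or.inr (Or.inl e.symm)
    · exact Or.inr (Or.inr e.symm)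

/-- The boundary of the polygon is a single closed chain. -/
lemma card_eq_minimalPeriod (h : IsXrayPolygon C A nx) {p : Fin 2 → ℤ} (hp : p ∈ C) {k : ℕ}
    (hk : 0 < k) (hkp : nx^[k] p = p) : C.card = Function.minimalPeriod nx p := by
  set N := Function.minimalPeriod nx p with hN
  have hNpos : 0 < N := Function.IsPeriodicPt.minimalPeriod_pos hk hkp
  have hmod : ∀ j, nx^[j] p = nx^[j % N] p := fun j =>
    (Function.iterate_mod_minimalPeriod_eq).symm
  have hC : C = (Finset.range N).image fun j => nx^[j] p := by
    ext x
    simp only [Finset.mem_image, Finset.mem_range]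
    refine ⟨fun hx => ?_, ?_⟩
    · suffices hs : ∃ j, nx^[j] p = x by
        obtain ⟨j, rfl⟩ := hs
        exact ⟨j % N, Nat.mod_lt _ hNpos, (hmod j).symm⟩
      obtain ⟨j, -, hj⟩ := Finset.exists_min_image (Finset.range N)
        (fun j => planeDet (nx x - x) (nx^[j] p - x)) ⟨0, Finset.mem_range.2 hNpos⟩
      have hmin : ∀ i, planeDet (nx x - x) (nx^[j] p - x) ≤
          planeDet (nx x - x) (nx^[i] p - x) := fun i => by
        rw [hmod i]
        exact hj _ (Finset.mem_range.2 (Nat.mod_lt _ hNpos))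
      have e : nx^[j] p = nx (nx^[j + N - 1] p) := by
        rw [← Function.iterate_succ_apply' nx, hmod (j + N - 1).succ, hmod j]
        congr 1
        rw [show (j + N - 1).succ = j + N by omega]
        simp
      have e2 : nx (nx (nx^[j + N - 1] p)) = nx^[j + 1] p := by
        rw [← e, Function.iterate_succ_apply']
      have ha := h.iterate_mem hp (j + N - 1)
      have := h.eq_or_eq_of_isMin ha hx (by rw [← e]; exact hmin _)
        (by rw [e2, ← e]; exact hmin _)
      rcases this with e' | e' | e'
      · exact ⟨_, e'.symm⟩
      · exact ⟨j, e.trans e'.symm⟩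
      · exact ⟨_, (h.next_injOn hx ha e').symm⟩
    · rintro ⟨j, -, rfl⟩
      exact h.iterate_mem hp j
  rw [hC, Finset.card_image_of_injOn, Finset.card_range]
  intro i hi j hj e
  exact Function.iterate_injOn_Iio_minimalPeriod (by simpa using hi) (by simpa using hj) e

lemma card_dvd (h : IsXrayPolygon C A nx) {p : Fin 2 → ℤ} (hp : p ∈ C) {k : ℕ}
    (hkp : nx^[k] p = p) : C.card ∣ k := by
  rcases k.eq_zero_or_pos with rfl | hk
  · exact dvd_zero _
  · rw [h.card_eq_minimalPeriod hp hk hkp]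
    exact Function.IsPeriodicPt.minimalPeriod_dvd hkp

lemma iterate_card (h : IsXrayPolygon C A nx) {p : Fin 2 → ℤ} (hp : p ∈ C) :
    nx^[C.card] p = p := by
  obtain ⟨i, j, hij, e⟩ : ∃ i j, i < j ∧ nx^[i] p = nx^[j] p := by
    obtain ⟨i, j, hij, e⟩ := Finite.exists_ne_map_eq_of_infinite
      (fun k : ℕ => (⟨nx^[k] p, h.iterate_mem hp k⟩ : C))
    simp only [Subtype.mk.injEq] at e
    rcases lt_or_gt_of_ne hij with hlt | hlt
    · exact ⟨i, j, hlt, e⟩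
    · exact ⟨j, i, hlt, e.symm⟩
  have key : ∀ i k, nx^[i] p = nx^[i + k] p → nx^[k] p = p := by
    intro i
    induction i with
    | zero => intro k e; simpa using e.symm
    | succ i ih =>
      intro k e
      rw [show i + 1 + k = (i + k) + 1 by omega, Function.iterate_succ_apply',
        Function.iterate_succ_apply'] at e
      exact ih k (h.next_injOn (h.iterate_mem hp _) (h.iterate_mem hp _) e)
  have := key i (j - i) (by rw [e]; congr 1; omega)
  rw [h.card_eq_minimalPeriod hp (by omega) this]
  exact Function.isPeriodicPt_minimalPeriod nx p

/-- If `b` and `c` lie on a line parallel to `u` and the chain `a, b` and `c, d` leaves this line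
on the same side, then the next line parallel to `u` that meets the polygon on this side
passes through `a` or `d`. -/
lemma eq_or_eq_of_planeDet_le (h : IsXrayPolygon C A nx) {u a c x : Fin 2 → ℤ}
    (ha : a ∈ C) (hc : c ∈ C) (hx : x ∈ C) (had : a ≠ nx c)
    (hbc : planeDet u (c - nx a) = 0) (h0 : 0 < planeDet u (x - nx a))
    (h1 : planeDet u (x - nx a) ≤ planeDet u (a - nx a))
    (h2 : planeDet u (x - nx a) ≤ planeDet u (nx c - c)) : x = a ∨ x = nx c := by
  by_contra! hne
  have hb := h.mem a ha
  have hd := h.mem c hc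
  have hxb : x ≠ nx a := by
    rintro rfl
    simp [planeDet] at h0
  have hxc : x ≠ c := by
    rintro rfl
    exact h0.ne' hbc
  have hL : 0 < planeDet (nx a - a) (x - a) := (h.left a ha x hx).lt_of_ne fun e => by
    have := h.eq_or a ha x hx e.symm
    tauto
  have hR : 0 < planeDet (nx c - c) (x - c) := (h.left c hc x hx).lt_of_ne fun e => by
    have := h.eq_or c hc x hx e.symm
    tauto
  have ga := h.left x hx a ha
  have gb := h.left x hx _ hb
  have gc := h.left x hx c hc
  have gd := h.left x hx _ hd
  have ea : planeDet u (x - nx a) * planeDet (nx x - x) (a - x) +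
      (planeDet u (a - nx a) - planeDet u (x - nx a)) * planeDet (nx x - x) (nx a - x) =
      - (planeDet (nx a - a) (x - a) * planeDet (nx x - x) u) := by
    simp only [planeDet, Pi.sub_apply]
    ring
  have ed : planeDet u (x - nx a) * planeDet (nx x - x) (nx c - x) +
      (planeDet u (nx c - c) - planeDet u (x - nx a)) * planeDet (nx x - x) (c - x) =
      planeDet (nx c - c) (x - c) * planeDet (nx x - x) u := by
    have : planeDet u (x - nx a) = planeDet u (x - c) := by
      simp only [planeDet, Pi.sub_apply] at *
      linarith
    rw [this]
    simp only [planeDet, Pi.sub_apply]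
    ring
  have m1 := mul_nonneg h0.le ga
  have m2 := mul_nonneg (sub_nonneg.2 h1) gb
  have m3 := mul_nonneg h0.le gd
  have m4 := mul_nonneg (sub_nonneg.2 h2) gc
  have w1 : planeDet (nx x - x) u ≤ 0 := by
    by_contra! hw
    have := mul_pos hL hw
    linarith
  have w2 : 0 ≤ planeDet (nx x - x) u := by
    by_contra! hw
    have := mul_neg_of_pos_of_neg hR hw
    linarith
  have w : planeDet (nx x - x) u = 0 := le_antisymm w1 w2
  rw [w, mul_zero] at ea ed
  have ga0 : planeDet (nx x - x) (a - x) = 0 := by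
    have : planeDet u (x - nx a) * planeDet (nx x - x) (a - x) = 0 := by linarith
    exact (mul_eq_zero.1 this).resolve_left h0.ne'
  have gd0 : planeDet (nx x - x) (nx c - x) = 0 := by
    have : planeDet u (x - nx a) * planeDet (nx x - x) (nx c - x) = 0 := by linarith
    exact (mul_eq_zero.1 this).resolve_left h0.ne'
  have r1 := (h.eq_or x hx a ha ga0).resolve_left hne.1.symm
  have r2 := (h.eq_or x hx _ hd gd0).resolve_left hne.2.symm
  exact had (r1.trans r2.symm)

/-- Under the assumptions of `eq_or_eq_of_planeDet_le`, the next line parallel to the edge at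
`q` passes through both `a` and `nx c`. -/
lemma planeDet_sub_eq_zero (h : IsXrayPolygon C A nx) {q a c : Fin 2 → ℤ}
    (hq : q ∈ C) (ha : a ∈ C) (hc : c ∈ C) (hac : nx c ∈ A ↔ a ∉ A)
    (hbc : planeDet (nx q - q) (c - nx a) = 0) (h1 : 0 < planeDet (nx q - q) (a - nx a))
    (h2 : 0 < planeDet (nx q - q) (nx c - c)) : planeDet (nx q - q) (nx c - a) = 0 := by
  have hd := h.mem c hc
  have had : a ≠ nx c := by
    intro e
    rw [← e] at hac
    tauto
  have hpartner := h.partner q hq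
  generalize nx q - q = u at *
  rcases le_total (planeDet u (a - nx a)) (planeDet u (nx c - c)) with hle | hle
  · obtain ⟨y, hy, hyA, hy0, -⟩ := hpartner a ha
    have e : planeDet u (y - nx a) = planeDet u (a - nx a) := by
      simp only [planeDet, Pi.sub_apply] at *
      linarith
    rcases h.eq_or_eq_of_planeDet_le ha hc hy had hbc (by rwa [e]) e.le (by rwa [e]) with rfl | rfl
    · tauto
    · exact hy0
  · obtain ⟨y, hy, hyA, hy0, -⟩ := hpartner _ hd
    have e : planeDet u (y - nx a) = planeDet u (nx c - c) := by
      simp only [planeDet, Pi.sub_apply] at *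
      linarith
    rcases h.eq_or_eq_of_planeDet_le ha hc hy had hbc (by rwa [e]) (by rwa [e]) e.le with rfl | rfl
    · simp only [planeDet, Pi.sub_apply] at *
      linarith
    · tauto

lemma planeDet_next_pos (h : IsXrayPolygon C A nx) (hC : 2 < C.card) {p : Fin 2 → ℤ}
    (hp : p ∈ C) : 0 < planeDet (nx p - p) (nx (nx p) - p) := by
  refine (h.left p hp _ (h.mem _ (h.mem p hp))).lt_of_ne fun e => ?_
  rcases h.eq_or p hp _ (h.mem _ (h.mem p hp)) e.symm with e | e
  · have := Nat.le_of_dvd two_pos (h.card_dvd hp (k := 2) e)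
    omega
  · exact h.next_ne (h.mem p hp) e

lemma planeDet_three_next (h : IsXrayPolygon C A nx) (hC : 2 < C.card) {p : Fin 2 → ℤ}
    (hp : p ∈ C) : planeDet (nx (nx p) - nx p) (nx (nx (nx p)) - p) = 0 := by
  have h1 := h.mem p hp
  have h2 := h.mem _ h1
  refine h.planeDet_sub_eq_zero h1 hp h2 ?_ ?_ ?_ ?_
  · have := h.color _ hp
    have := h.color _ h1
    have := h.color _ h2
    tauto
  · simp only [planeDet]
    ring
  · have := h.planeDet_next_pos hC hp
    simp only [planeDet, Pi.sub_apply] at *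
    linarith
  · have := h.planeDet_next_pos hC h1
    simp only [planeDet, Pi.sub_apply] at *
    linarith

/-- Outside four consecutive vertices, the polygon lies strictly beyond the chord parallel to the
middle edge. -/
lemma lt_planeDet (h : IsXrayPolygon C A nx) (hC : 2 < C.card) {p x : Fin 2 → ℤ}
    (hp : p ∈ C) (hx : x ∈ C) (hx0 : x ≠ p) (hx1 : x ≠ nx p) (hx2 : x ≠ nx (nx p))
    (hx3 : x ≠ nx (nx (nx p))) : 0 < planeDet (nx (nx p) - nx p) (x - p) := by
  have h1 := h.mem p hp
  have h2 := h.mem _ h1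
  have h3 := h.mem _ h2
  have c0 := h.color _ hp
  have c1 := h.color _ h1
  have c2 := h.color _ h2
  have h03 := h.planeDet_three_next hC hp
  have hpos : 0 < planeDet (nx (nx p) - nx p) (x - nx p) :=
    (h.left _ h1 x hx).lt_of_ne fun e => by
      have := h.eq_or _ h1 x hx e.symm
      tauto
  have hne : planeDet (nx (nx p) - nx p) (x - p) ≠ 0 := by
    intro e
    obtain ⟨y, hy, hyA, hy0, huniq⟩ := h.partner _ h1 p hp
    have e3 := (huniq _ h3 h03).resolve_left (by
      intro e
      rw [e] at c2
      tauto)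
    rcases huniq x hx e with e | e
    · exact hx0 e
    · exact hx3 (e.trans e3.symm)
  by_contra! hle
  have hlt := lt_of_le_of_ne hle hne
  have had : p ≠ nx (nx (nx p)) := by
    intro e
    rw [← e] at c2
    tauto
  have := h.eq_or_eq_of_planeDet_le (u := nx (nx p) - nx p) hp h2 hx had
    (by simp only [planeDet]; ring) hpos
    (by simp only [planeDet, Pi.sub_apply] at *; linarith)
    (by simp only [planeDet, Pi.sub_apply] at *; linarith)
  tauto

lemma planeDet_five_next (h : IsXrayPolygon C A nx) (hC : 4 < C.card) {p : Fin 2 → ℤ}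
    (hp : p ∈ C) : planeDet (nx (nx (nx p)) - nx (nx p)) (nx (nx (nx (nx (nx p)))) - p) = 0 := by
  have h1 := h.mem p hp
  have h2 := h.mem _ h1
  have h3 := h.mem _ h2
  have h4 := h.mem _ h3
  have h5 := h.mem _ h4
  have c0 := h.color _ hp
  have c1 := h.color _ h1
  have c2 := h.color _ h2
  have c3 := h.color _ h3
  have c4 := h.color _ h4
  have ne_of_color : ∀ x y : Fin 2 → ℤ, (x ∈ A ↔ y ∉ A) → x ≠ y := by
    rintro x y hxy rfl
    tauto
  have ne2 : ∀ q ∈ C, q ≠ nx (nx q) := fun q hq e => by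
    have := Nat.le_of_dvd two_pos (h.card_dvd hq (k := 2) e.symm)
    omega
  have ne4 : ∀ q ∈ C, q ≠ nx (nx (nx (nx q))) := fun q hq e => by
    have := Nat.le_of_dvd four_pos (h.card_dvd hq (k := 4) e.symm)
    omega
  refine h.planeDet_sub_eq_zero h2 hp h4 (by tauto) (h.planeDet_three_next (by omega) h1) ?_ ?_
  · exact h.lt_planeDet (by omega) h1 hp (ne_of_color _ _ (by tauto)) (ne2 p hp)
      (ne_of_color _ _ (by tauto)) (ne4 p hp)
  · have h14 := h.planeDet_three_next (by omega) h1
    have := h.lt_planeDet (by omega) h1 h5 (ne4 _ h1).symm (ne_of_color _ _ (by tauto))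
      (ne2 _ h3).symm (ne_of_color _ _ (by tauto))
    simp only [planeDet, Pi.sub_apply] at *
    linarith

end IsXrayPolygon

/-- The ratio in a three-term recurrence with a nonzero periodic integral solution is an integer. -/
lemma dvd_of_periodic_recurrence {x : ℕ → ℤ} {n : ℕ} (hn : 0 < n) (hper : ∀ j, x (j + n) = x j)
    {q r : ℤ} (hq : 0 < q) (hrec : ∀ j, q * (x (j + 2) + x j) = r * x (j + 1))
    {k : ℕ} (hk : x k ≠ 0) : q ∣ r := by
  obtain ⟨g, q', r', hg, hcop, rfl, rfl⟩ : ∃ g q' r' : ℤ, g ≠ 0 ∧ IsCoprime q' r' ∧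
      q = g * q' ∧ r = g * r' := by
    have hg : 0 < Int.gcd q r := Int.gcd_pos_of_ne_zero_left _ hq.ne'
    obtain ⟨q', r', h, h1, h2⟩ := Int.exists_gcd_one hg
    exact ⟨Int.gcd q r, q', r', by exact_mod_cast hg.ne', Int.isCoprime_iff_gcd_eq_one.2 h,
      by rw [mul_comm]; exact h1, by rw [mul_comm]; exact h2⟩
  have hrec' : ∀ j, q' * (x (j + 2) + x j) = r' * x (j + 1) := fun j =>
    mul_left_cancel₀ hg (by linear_combination hrec j)
  have hpow : ∀ e j, q' ^ e ∣ x j := by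
    intro e
    induction e with
    | zero => simp
    | succ e ih =>
      intro j
      rw [← hper j, show j + n = (j + n - 1) + 1 by omega]
      refine (hcop.pow_left (m := e + 1)).dvd_of_dvd_mul_left ?_
      rw [← hrec', pow_succ']
      exact mul_dvd_mul_left _ (dvd_add (ih _) (ih _))
  have hunit : IsUnit q' := by
    by_contra hu
    have hfin : FiniteMultiplicity q' (x k) := Int.finiteMultiplicity_iff.2
      ⟨fun h => hu (Int.isUnit_iff_natAbs_eq.2 h), hk⟩
    obtain ⟨e, he⟩ := hfin
    exact he (hpow _ _)
  exact mul_dvd_mul_left g hunit.dvd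

lemma abs_le_two_of_periodic_recurrence {x : ℕ → ℤ} {n : ℕ} (hn : 0 < n)
    (hper : ∀ j, x (j + n) = x j) {l : ℤ} (hrec : ∀ j, x (j + 2) + x j = l * x (j + 1))
    {k : ℕ} (hk : x k ≠ 0) : |l| ≤ 2 := by
  have hper' : Function.Periodic x n := hper
  obtain ⟨j, -, hj⟩ := Finset.exists_max_image (Finset.range n) (fun j => |x j|)
    ⟨0, Finset.mem_range.2 hn⟩
  have hmax : ∀ i, |x i| ≤ |x j| := fun i => by
    rw [← hper'.map_mod_nat i]
    exact hj _ (Finset.mem_range.2 (Nat.mod_lt _ hn))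
  have hpos : 0 < |x j| := (abs_pos.2 hk).trans_le (hmax k)
  have e := hrec (j + n - 1)
  rw [show j + n - 1 + 1 = j + n by omega, hper] at e
  have h1 : |l| * |x j| ≤ |x j| + |x j| := by
    rw [← abs_mul, ← e]
    exact (abs_add_le _ _).trans (add_le_add (hmax _) (hmax _))
  nlinarith

lemma periodic_arithmetic {x : ℕ → ℤ} {n : ℕ} (hn : 0 < n) (hper : x n = x 0)
    (hrec : ∀ j, x (j + 2) + x j = 2 * x (j + 1)) : x 1 = x 0 := by
  have h : ∀ j : ℕ, x j = x 0 + j * (x 1 - x 0) ∧ x (j + 1) = x 0 + (j + 1) * (x 1 - x 0) := by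
    intro j
    induction j with
    | zero => simp
    | succ j ih =>
      refine ⟨by push_cast; exact ih.2, ?_⟩
      push_cast
      linear_combination hrec j + 2 * ih.2 - ih.1
  have := (h n).1
  rw [hper, left_eq_add, mul_eq_zero] at this
  rcases this with h | h
  · have : n = 0 := by exact_mod_cast h
    omega
  · linarith

/-- The crystallographic restriction for three-term recurrences. -/
lemma exists_period_of_abs_le_two {l : ℤ} (hl : |l| ≤ 2) :
    ∃ d : ℕ, (d = 1 ∨ d = 2 ∨ d = 3 ∨ d = 4 ∨ d = 6) ∧ ∀ (x : ℕ → ℤ) (n : ℕ), 0 < n →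
      (∀ j, x (j + n) = x j) → (∀ j, x (j + 2) + x j = l * x (j + 1)) → x d = x 0 := by
  obtain ⟨h1, h2⟩ := abs_le.1 hl
  interval_cases l
  · refine ⟨2, by simp, fun x n hn hper hrec => ?_⟩
    have h := periodic_arithmetic (x := fun j => (-1) ^ j * x j) (n := 2 * n) (by omega)
      (by
        have : x (2 * n) = x 0 := by rw [two_mul, hper, ← hper 0, zero_add]
        simp [this])
      (fun j => by
        simp only [pow_succ]
        linear_combination (-1) ^ j * hrec j)
    have := hrec 0
    simp at h this
    linarith
  · refine ⟨3, by simp, fun x n hn hper hrec => ?_⟩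
    have h0 := hrec 0
    have h1 := hrec 1
    simp at h0 h1
    linarith
  · refine ⟨4, by simp, fun x n hn hper hrec => ?_⟩
    have h0 := hrec 0
    have h2 := hrec 2
    simp at h0 h2
    linarith
  · refine ⟨6, by simp, fun x n hn hper hrec => ?_⟩
    have h0 := hrec 0
    have h1 := hrec 1
    have h3 := hrec 3
    have h4 := hrec 4
    simp at h0 h1 h3 h4
    linarith
  · exact ⟨1, by simp, fun x n hn hper hrec =>
      periodic_arithmetic hn (by simpa using hper 0) hrec⟩

namespace IsXrayPolygon

variable {C : Finset (Fin 2 → ℤ)} {A : Set (Fin 2 → ℤ)} {nx : (Fin 2 → ℤ) → (Fin 2 → ℤ)}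

lemma iterate_even_mem_iff (h : IsXrayPolygon C A nx) {p : Fin 2 → ℤ} (hp : p ∈ C) (d : ℕ) :
    nx^[2 * d] p ∈ A ↔ p ∈ A := by
  induction d with
  | zero => simp
  | succ d ih =>
    have hm := h.iterate_mem hp (2 * d)
    have h1 := h.color _ hm
    have h2 := h.color _ (h.mem _ hm)
    rw [show 2 * (d + 1) = 2 * d + 1 + 1 by ring, Function.iterate_succ_apply',
      Function.iterate_succ_apply']
    tauto

/-- Every second edge vector satisfies a three-term recurrence with constant coefficients. -/
lemma exists_recurrence (h : IsXrayPolygon C A nx) (hC : 4 < C.card) {p : Fin 2 → ℤ}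
    (hp : p ∈ C) {v : ℕ → Fin 2 → ℤ} (hv : ∀ i, v i = nx^[i + 1] p - nx^[i] p) :
    ∃ q r : ℤ, 0 < q ∧ ∀ j t, q * (v (2 * (j + 2)) t + v (2 * j) t) = r * v (2 * (j + 1)) t := by
  have hD0 : ∀ i, 0 < planeDet (v i) (v (i + 1)) := fun i => by
    have := h.planeDet_next_pos (by omega) (h.iterate_mem hp i)
    simp only [← Function.iterate_succ_apply' nx] at this
    simp only [hv, planeDet, Pi.sub_apply, Nat.succ_eq_add_one] at *
    linarith
  have hDstep : ∀ i, planeDet (v (i + 1)) (v (i + 2)) = planeDet (v i) (v (i + 1)) := fun i => by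
    have := h.planeDet_three_next (by omega) (h.iterate_mem hp i)
    simp only [← Function.iterate_succ_apply' nx] at this
    simp only [hv, planeDet, Pi.sub_apply, Nat.succ_eq_add_one] at *
    linarith
  have hEstep : ∀ i, planeDet (v (i + 2)) (v (i + 4)) = planeDet (v i) (v (i + 2)) := fun i => by
    have h5 := h.planeDet_five_next hC (h.iterate_mem hp i)
    have h3 := hDstep (i + 1)
    simp only [← Function.iterate_succ_apply' nx] at h5
    simp only [hv, planeDet, Pi.sub_apply, Nat.succ_eq_add_one] at *
    linarith
  set D := planeDet (v 0) (v 1)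
  have hD : ∀ i, planeDet (v i) (v (i + 1)) = D := fun i => by
    induction i with
    | zero => rfl
    | succ i ih => rw [hDstep, ih]
  have hE : ∀ j, planeDet (v (2 * j)) (v (2 * j + 2)) = planeDet (v 0) (v 2) ∧
      planeDet (v (2 * j + 1)) (v (2 * j + 3)) = planeDet (v 1) (v 3) := fun j => by
    induction j with
    | zero => exact ⟨rfl, rfl⟩
    | succ j ih => exact ⟨(hEstep (2 * j)).trans ih.1, (hEstep (2 * j + 1)).trans ih.2⟩
  have hrec : ∀ i t, D * (v i t + v (i + 2) t) = planeDet (v i) (v (i + 2)) * v (i + 1) t := by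
    intro i t
    have e1 := hD i
    have e2 := hD (i + 1)
    simp only [planeDet] at e1 e2 ⊢
    fin_cases t
    · simp only [Fin.zero_eta]
      linear_combination -(v i 0) * e2 - (v (i + 2) 0) * e1
    · simp only [Fin.mk_one]
      linear_combination -(v i 1) * e2 - (v (i + 2) 1) * e1
  refine ⟨D ^ 2, planeDet (v 0) (v 2) * planeDet (v 1) (v 3) - 2 * D ^ 2,
    pow_pos (hD0 0) 2, fun j t => ?_⟩
  have r0 := hrec (2 * j) t
  have r1 := hrec (2 * j + 1) t
  have r2 := hrec (2 * j + 2) t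
  rw [(hE j).1] at r0
  rw [(hE j).2] at r1
  rw [show 2 * j + 2 = 2 * (j + 1) by ring, (hE (j + 1)).1] at r2
  rw [show 2 * (j + 2) = 2 * (j + 1) + 2 by ring]
  simp only [show 2 * j + 1 + 2 = 2 * (j + 1) + 1 by ring,
    show 2 * j + 1 + 1 = 2 * (j + 1) by ring] at *
  linear_combination D * r0 + D * r2 + planeDet (v 0) (v 2) * r1

/-- The crystallographic restriction on the number of vertices. -/
lemma exists_card_dvd (h : IsXrayPolygon C A nx) (hC : 4 < C.card) :
    ∃ d : ℕ, (d = 1 ∨ d = 2 ∨ d = 3 ∨ d = 4 ∨ d = 6) ∧ C.card ∣ 2 * d := by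
  obtain ⟨p, hp⟩ := Finset.card_pos.1 (by omega : 0 < C.card)
  obtain ⟨v, hv⟩ : ∃ v : ℕ → Fin 2 → ℤ, ∀ i, v i = nx^[i + 1] p - nx^[i] p := ⟨_, fun _ => rfl⟩
  obtain ⟨q, r, hq, hrec⟩ := h.exists_recurrence hC hp hv
  have hper : ∀ i t, v (2 * (i + C.card)) t = v (2 * i) t := fun i t => by
    have hp' : Function.IsPeriodicPt nx (2 * C.card) p :=
      Function.IsPeriodicPt.const_mul (h.iterate_card hp) 2
    have key : ∀ j, nx^[j + 2 * C.card] p = nx^[j] p := fun j => by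
      rw [Function.iterate_add_apply, hp'.eq]
    rw [hv, hv, show 2 * (i + C.card) = 2 * i + 2 * C.card by ring,
      show 2 * i + 2 * C.card + 1 = (2 * i + 1) + 2 * C.card by ring, key, key]
  obtain ⟨t, ht⟩ : ∃ t, v (2 * 0) t ≠ 0 := by
    by_contra! h0
    refine h.next_ne hp (funext fun t => ?_)
    have := h0 t
    rw [hv] at this
    simpa [sub_eq_zero] using this
  obtain ⟨l, rfl⟩ := dvd_of_periodic_recurrence (x := fun i => v (2 * i) t) (by omega)
    (fun i => hper i t) hq (fun j => hrec j t) ht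
  have hrec' : ∀ j t, v (2 * (j + 2)) t + v (2 * j) t = l * v (2 * (j + 1)) t := fun j t =>
    mul_left_cancel₀ hq.ne' (by linear_combination hrec j t)
  obtain ⟨d, hd, hd'⟩ := exists_period_of_abs_le_two (abs_le_two_of_periodic_recurrence
    (x := fun i => v (2 * i) t) (by omega) (fun i => hper i t) (fun j => hrec' j t) ht)
  refine ⟨d, hd, h.card_dvd hp ?_⟩
  have hvd : v (2 * d) = v 0 := funext fun t =>
    hd' (fun i => v (2 * i) t) C.card (by omega) (fun i => hper i t) (fun j => hrec' j t)
  have hm := h.iterate_mem hp (2 * d)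
  rw [hv, hv, Function.iterate_succ_apply'] at hvd
  have h1 := h.left p hp _ hm
  have h2 := h.left _ hm p hp
  rw [hvd] at h2
  have h3 : planeDet (nx p - p) (nx^[2 * d] p - p) = 0 := by
    simp only [planeDet, Pi.sub_apply, zero_add, Function.iterate_one, Function.iterate_zero,
      id_eq] at *
    linarith
  refine (h.eq_or p hp _ hm h3).resolve_right fun e => ?_
  have c1 := h.iterate_even_mem_iff hp d
  have c2 := h.color p hp
  rw [e] at c1
  tauto

end IsXrayPolygon

section Construction

variable {m : ℕ} {A B : Finset (Fin 2 → ℤ)} {s : Fin m → Fin 2 → ℤ}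

lemma le_card_of_forall_exists (hs : ∀ i j, i ≠ j → planeDet (s i) (s j) ≠ 0)
    {x : Fin 2 → ℤ} (hx : x ∉ A) (hex : ∀ i, ∃ y ∈ A, planeDet (s i) (y - x) = 0) :
    m ≤ A.card ∧ (A.card ≤ m → ∀ i, ∀ y ∈ A, ∀ z ∈ A, planeDet (s i) (y - x) = 0 →
      planeDet (s i) (z - x) = 0 → y = z) := by
  have hdir : ∀ i j, ∀ y ∈ A, planeDet (s i) (y - x) = 0 → planeDet (s j) (y - x) = 0 →
      i = j := by
    intro i j y hy hi hj
    by_contra hij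
    have := sub_eq_zero.1 (eq_zero_of_planeDet_eq_zero (hs i j hij) hi hj)
    exact hx (this ▸ hy)
  choose f hfA hf using hex
  have hinj : Function.Injective f := fun i j e => hdir i j (f i) (hfA i) (hf i) (e ▸ hf j)
  have hcard : (Finset.univ.image f).card = m := by
    rw [Finset.card_image_of_injective _ hinj, Finset.card_univ, Fintype.card_fin]
  have hsub : Finset.univ.image f ⊆ A := by
    intro y hy
    obtain ⟨i, -, rfl⟩ := Finset.mem_image.1 hy
    exact hfA i
  refine ⟨hcard ▸ Finset.card_le_card hsub, fun hle i y hy z hz hyi hzi => ?_⟩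
  have heq := Finset.eq_of_subset_of_card_le hsub (hcard.symm ▸ hle)
  have key : ∀ y ∈ A, planeDet (s i) (y - x) = 0 → y = f i := by
    intro y hy hyi
    rw [← heq] at hy
    obtain ⟨j, -, rfl⟩ := Finset.mem_image.1 hy
    rw [hdir i j _ (hfA j) hyi (hf j)]
  rw [key y hy hyi, key z hz hzi]

lemma exists_mem_of_card_filter_eq {u x : Fin 2 → ℤ}
    (h : (A.filter fun y => planeDet u (y - x) = 0).card =
      (B.filter fun y => planeDet u (y - x) = 0).card) (hx : x ∈ A) :
    ∃ y ∈ B, planeDet u (y - x) = 0 := by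
  have : 0 < (A.filter fun y => planeDet u (y - x) = 0).card :=
    Finset.card_pos.2 ⟨x, Finset.mem_filter.2 ⟨hx, by simp [planeDet]⟩⟩
  rw [h, Finset.card_pos] at this
  obtain ⟨y, hy⟩ := this
  exact ⟨y, Finset.mem_filter.1 hy⟩

lemma card_eq_of_card_filter_eq {u : Fin 2 → ℤ}
    (h : ∀ x, (A.filter fun y => planeDet u (y - x) = 0).card =
      (B.filter fun y => planeDet u (y - x) = 0).card) : A.card = B.card := by
  rw [Finset.card_eq_sum_card_fiberwise (f := planeDet u) (t := (A ∪ B).image (planeDet u))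
      (fun x hx => Finset.mem_coe.2
        (Finset.mem_image_of_mem _ (Finset.mem_union_left _ hx))),
    Finset.card_eq_sum_card_fiberwise (s := B) (f := planeDet u)
      (t := (A ∪ B).image (planeDet u))
      (fun x hx => Finset.mem_coe.2
        (Finset.mem_image_of_mem _ (Finset.mem_union_right _ hx)))]
  refine Finset.sum_congr rfl fun t ht => ?_
  obtain ⟨x, -, rfl⟩ := Finset.mem_image.1 ht
  have e : ∀ y, planeDet u y = planeDet u x ↔ planeDet u (y - x) = 0 := fun y => by
    simp only [planeDet, Pi.sub_apply]
    constructor <;> intro <;> linarith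
  simp only [e]
  exact h x

/-- If `m` X-rays of two disjoint nonempty sets agree and one of the sets has at most `m` points,
then both sets have `m` points, and each line in one of the given directions that meets one of
them contains exactly one point of each. -/
lemma card_eq_and_exists_partner (hs : ∀ i j, i ≠ j → planeDet (s i) (s j) ≠ 0)
    (hAB : Disjoint A B) (hA : A.Nonempty) (hAm : A.card ≤ m)
    (hx : ∀ i x, (A.filter fun y => planeDet (s i) (y - x) = 0).card =
      (B.filter fun y => planeDet (s i) (y - x) = 0).card) :
    (A ∪ B).card = 2 * m ∧ ∀ i, ∀ x ∈ A ∪ B, ∃ y ∈ A ∪ B, (y ∈ A ↔ x ∉ A) ∧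
      planeDet (s i) (y - x) = 0 ∧
      ∀ z ∈ A ∪ B, planeDet (s i) (z - x) = 0 → z = x ∨ z = y := by
  have hm : 0 < m := (Finset.card_pos.2 hA).trans_le hAm
  have hcard : A.card = B.card := card_eq_of_card_filter_eq (hx ⟨0, hm⟩)
  have exB : ∀ i, ∀ x ∈ A, ∃ y ∈ B, planeDet (s i) (y - x) = 0 := fun i x hxA =>
    exists_mem_of_card_filter_eq (hx i x) hxA
  have exA : ∀ i, ∀ x ∈ B, ∃ y ∈ A, planeDet (s i) (y - x) = 0 := fun i x hxB =>
    exists_mem_of_card_filter_eq (hx i x).symm hxB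
  have notA : ∀ x ∈ B, x ∉ A := fun x hB hA => Finset.disjoint_left.1 hAB hA hB
  have notB : ∀ x ∈ A, x ∉ B := fun x hA hB => Finset.disjoint_left.1 hAB hA hB
  have unA := fun x hxB => (le_card_of_forall_exists hs (notA x hxB) (exA · x hxB)).2 hAm
  have unB := fun x hxA =>
    (le_card_of_forall_exists hs (notB x hxA) (exB · x hxA)).2 (hcard ▸ hAm)
  have neg : ∀ {i : Fin m} {x y : Fin 2 → ℤ}, planeDet (s i) (y - x) = 0 →
      planeDet (s i) (x - y) = 0 := by
    intro i x y e
    simp only [planeDet, Pi.sub_apply] at *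
    linarith
  have trans : ∀ {i : Fin m} {x y z : Fin 2 → ℤ}, planeDet (s i) (y - x) = 0 →
      planeDet (s i) (z - x) = 0 → planeDet (s i) (z - y) = 0 := by
    intro i x y z e e'
    simp only [planeDet, Pi.sub_apply] at *
    linarith
  refine ⟨?_, fun i x hxC => ?_⟩
  · obtain ⟨x, hxA⟩ := hA
    have := (le_card_of_forall_exists hs (notB x hxA) (exB · x hxA)).1
    rw [Finset.card_union_of_disjoint hAB]
    omega
  · rcases Finset.mem_union.1 hxC with hxA | hxB
    · obtain ⟨y, hyB, hy⟩ := exB i x hxA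
      refine ⟨y, Finset.mem_union_right _ hyB, by simp [hxA, notA y hyB], hy, fun z hz hzx => ?_⟩
      rcases Finset.mem_union.1 hz with hzA | hzB
      · exact Or.inl (unA y hyB i z hzA x hxA (trans hy hzx) (neg hy))
      · exact Or.inr (unB x hxA i z hzB y hyB hzx hy)
    · obtain ⟨y, hyA, hy⟩ := exA i x hxB
      refine ⟨y, Finset.mem_union_left _ hyA, by simp [hyA, notA x hxB], hy, fun z hz hzx => ?_⟩
      rcases Finset.mem_union.1 hz with hzA | hzB
      · exact Or.inr (unA x hxB i z hzA y hyA hzx hy)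
      · exact Or.inl (unB y hyA i z hzB x hxB (trans hy hzx) (neg hy))

lemma exists_edge {C : Finset (Fin 2 → ℤ)} (hC : C.Nonempty) {A : Set (Fin 2 → ℤ)}
    {u : Fin 2 → ℤ} (hu : u ≠ 0)
    (hpart : ∀ x ∈ C, ∃ y ∈ C, (y ∈ A ↔ x ∉ A) ∧ planeDet u (y - x) = 0 ∧
      ∀ z ∈ C, planeDet u (z - x) = 0 → z = x ∨ z = y) :
    ∃ x ∈ C, ∃ y ∈ C, (y ∈ A ↔ x ∉ A) ∧ planeDet u (y - x) = 0 ∧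
      0 < u 0 * (y - x) 0 + u 1 * (y - x) 1 ∧
      ∀ z ∈ C, 0 ≤ planeDet (y - x) (z - x) ∧
        (planeDet (y - x) (z - x) = 0 → z = x ∨ z = y) := by
  have hu2 : 0 < u 0 ^ 2 + u 1 ^ 2 := by
    by_contra! hle
    have h0 : u 0 = 0 := by nlinarith [sq_nonneg (u 0), sq_nonneg (u 1)]
    have h1 : u 1 = 0 := by nlinarith [sq_nonneg (u 0), sq_nonneg (u 1)]
    exact hu (funext fun i => by fin_cases i <;> assumption)
  have key : ∀ x y : Fin 2 → ℤ, planeDet u (y - x) = 0 →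
      0 < u 0 * (y - x) 0 + u 1 * (y - x) 1 → (∀ z ∈ C, 0 ≤ planeDet u (z - x)) →
      (∀ z ∈ C, planeDet u (z - x) = 0 → z = x ∨ z = y) →
      ∀ z ∈ C, 0 ≤ planeDet (y - x) (z - x) ∧
        (planeDet (y - x) (z - x) = 0 → z = x ∨ z = y) := by
    intro x y hxy hdot hmin hun z hz
    have e : (u 0 ^ 2 + u 1 ^ 2) * planeDet (y - x) (z - x) =
        (u 0 * (y - x) 0 + u 1 * (y - x) 1) * planeDet u (z - x) := by
      simp only [planeDet, Pi.sub_apply] at *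
      linear_combination (-(u 0 * (z 0 - x 0)) - u 1 * (z 1 - x 1)) * hxy
    refine ⟨?_, fun h0 => hun z hz ?_⟩
    · have := mul_nonneg hdot.le (hmin z hz)
      rw [← e] at this
      exact nonneg_of_mul_nonneg_right this hu2
    · rw [h0, mul_zero] at e
      exact (mul_eq_zero.1 e.symm).resolve_left hdot.ne'
  obtain ⟨x, hx, hmin⟩ := Finset.exists_min_image C (planeDet u) hC
  obtain ⟨y, hy, hyx, hdet, hun⟩ := hpart x hx
  have hmin' : ∀ z ∈ C, 0 ≤ planeDet u (z - x) := fun z hz => by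
    have := hmin z hz
    simp only [planeDet, Pi.sub_apply] at *
    linarith
  rcases lt_trichotomy (u 0 * (y - x) 0 + u 1 * (y - x) 1) 0 with hd | hd | hd
  · have e : ∀ z, planeDet u (z - y) = planeDet u (z - x) := fun z => by
      simp only [planeDet, Pi.sub_apply] at *
      linarith
    have hdet' : planeDet u (x - y) = 0 := by rw [e]; simp [planeDet]
    have hd' : 0 < u 0 * (x - y) 0 + u 1 * (x - y) 1 := by
      simp only [Pi.sub_apply] at *
      linarith
    exact ⟨y, hy, x, hx, by tauto, hdet', hd', key y x hdet' hd'
      (fun z hz => by rw [e]; exact hmin' z hz)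
      (fun z hz h0 => (hun z hz (by rwa [e] at h0)).symm)⟩
  · exfalso
    have h0 : (u 0 ^ 2 + u 1 ^ 2) * (y - x) 0 = 0 := by
      simp only [planeDet] at hdet
      linear_combination u 0 * hd - u 1 * hdet
    have h1 : (u 0 ^ 2 + u 1 ^ 2) * (y - x) 1 = 0 := by
      simp only [planeDet] at hdet
      linear_combination u 1 * hd + u 0 * hdet
    have h0' := (mul_eq_zero.1 h0).resolve_left hu2.ne'
    have h1' := (mul_eq_zero.1 h1).resolve_left hu2.ne'
    have : y = x := sub_eq_zero.1 (funext fun i => by fin_cases i <;> assumption)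
    rw [this] at hyx
    tauto
  · exact ⟨x, hx, y, hy, hyx, hdet, hd, key x y hdet hd hmin' hun⟩

lemma exists_isXrayPolygon {C : Finset (Fin 2 → ℤ)} (hC : C.Nonempty) {A : Set (Fin 2 → ℤ)}
    (hs0 : ∀ i, s i ≠ 0) (hs : ∀ i j, i ≠ j → planeDet (s i) (s j) ≠ 0) (hcard : C.card = 2 * m)
    (hpart : ∀ i, ∀ x ∈ C, ∃ y ∈ C, (y ∈ A ↔ x ∉ A) ∧ planeDet (s i) (y - x) = 0 ∧
      ∀ z ∈ C, planeDet (s i) (z - x) = 0 → z = x ∨ z = y) :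
    ∃ nx, IsXrayPolygon C A nx := by
  have hedge : ∀ k : Fin m × ℤˣ, ∃ x ∈ C, ∃ y ∈ C, (y ∈ A ↔ x ∉ A) ∧
      planeDet (s k.1) (y - x) = 0 ∧
      0 < (k.2 : ℤ) * (s k.1 0 * (y - x) 0 + s k.1 1 * (y - x) 1) ∧
      ∀ z ∈ C, 0 ≤ planeDet (y - x) (z - x) ∧
        (planeDet (y - x) (z - x) = 0 → z = x ∨ z = y) := by
    rintro ⟨i, e⟩
    have hdet : ∀ w, planeDet ((e : ℤ) • s i) w = 0 ↔ planeDet (s i) w = 0 := fun w => by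
      have : planeDet ((e : ℤ) • s i) w = e * planeDet (s i) w := by
        simp only [planeDet, Pi.smul_apply, smul_eq_mul]
        ring
      rw [this]
      simp
    obtain ⟨x, hx, y, hy, h1, h2, h3, h4⟩ := exists_edge hC (A := A) (u := (e : ℤ) • s i)
      (smul_ne_zero e.ne_zero (hs0 i)) (by simpa only [hdet] using hpart i)
    refine ⟨x, hx, y, hy, h1, (hdet _).1 h2, ?_, h4⟩
    simp only [Pi.smul_apply, smul_eq_mul] at h3
    linarith
  choose f hfC g hgC hcol hdet hdot hleft using hedge
  have hne : ∀ k, g k - f k ≠ 0 := fun k e => by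
    have := hcol k
    rw [sub_eq_zero.1 e] at this
    tauto
  have hinj : Function.Injective f := by
    intro k l e
    have h1 := hleft k (g l) (hgC l)
    have h2 := (hleft l (g k) (hgC k)).1
    have h3 : planeDet (g k - f k) (g l - f k) = 0 := by
      rw [← e] at h2
      simp only [planeDet] at *
      linarith
    have h4 : g l = g k := (h1.2 h3).resolve_left fun e' => hne l (by rw [e', e, sub_self])
    have h5 : k.1 = l.1 := by
      by_contra hkl
      exact hne k (eq_zero_of_planeDet_eq_zero (hs _ _ hkl) (hdet k) (by rw [← h4, e]; exact hdet l))
    have d1 := hdot k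
    have d2 := hdot l
    rw [h4, ← e, ← h5] at d2
    refine Prod.ext h5 ?_
    rcases Int.units_eq_one_or k.2 with a | a <;> rcases Int.units_eq_one_or l.2 with b | b <;>
      rw [a] at d1 ⊢ <;> rw [b] at d2 ⊢ <;> exfalso <;> simp at d1 d2 <;> linarith
  have himage : Finset.univ.image f = C := by
    refine Finset.eq_of_subset_of_card_le ?_ ?_
    · intro x hx
      obtain ⟨k, -, rfl⟩ := Finset.mem_image.1 hx
      exact hfC k
    · rw [Finset.card_image_of_injective _ hinj, hcard, Finset.card_univ, Fintype.card_prod,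
        Fintype.card_fin, Fintype.card_units_int]
      omega
  have hsurj : ∀ p ∈ C, ∃ k, f k = p := fun p hp => by
    rw [← himage] at hp
    obtain ⟨k, -, e⟩ := Finset.mem_image.1 hp
    exact ⟨k, e⟩
  have hnx : ∀ p, ∃ y, p ∈ C → ∃ k, f k = p ∧ g k = y := fun p => by
    by_cases hp : p ∈ C
    · obtain ⟨k, e⟩ := hsurj p hp
      exact ⟨g k, fun _ => ⟨k, e, rfl⟩⟩
    · exact ⟨p, fun h => absurd h hp⟩
  choose nx hnx using hnx
  refine ⟨nx, ?_, ?_, ?_, ?_, ?_⟩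
  · intro p hp
    obtain ⟨k, -, e⟩ := hnx p hp
    exact e ▸ hgC k
  · intro p hp
    obtain ⟨k, e, e'⟩ := hnx p hp
    rw [← e', ← e]
    exact hcol k
  · intro p hp x hx
    obtain ⟨k, e, e'⟩ := hnx p hp
    rw [← e', ← e]
    exact (hleft k x hx).1
  · intro p hp x hx
    obtain ⟨k, e, e'⟩ := hnx p hp
    rw [← e', ← e]
    exact (hleft k x hx).2
  · intro p hp x hx
    obtain ⟨k, e, e'⟩ := hnx p hp
    have hpar : ∀ w, planeDet (nx p - p) w = 0 ↔ planeDet (s k.1) w = 0 := fun w => by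
      have hd := hdet k
      have hn := hne k
      rw [e, e'] at hd hn
      have hd' : planeDet (nx p - p) (s k.1) = 0 := by
        simp only [planeDet] at *
        linarith
      have swap : ∀ a b : Fin 2 → ℤ, planeDet a b = 0 → planeDet b a = 0 := fun a b h => by
        simp only [planeDet] at *
        linarith
      constructor <;> intro hw <;> by_contra hne'
      · exact hn (eq_zero_of_planeDet_eq_zero hne' hd (swap _ _ hw))
      · exact hs0 k.1 (eq_zero_of_planeDet_eq_zero hne' hd' (swap _ _ hw))
    simp only [hpar]
    exact hpart k.1 x hx

end Construction

lemma castVec_mem_lineThrough_iff {s : Fin 2 → ℤ} (hs : s ≠ 0) (p x : Fin 2 → ℤ) :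
    castVec x ∈ lineThrough (castVec p) (castVec s) ↔ planeDet s (x - p) = 0 := by
  have hcast : planeDet s (x - p) = 0 ↔
      (s 0 : ℝ) * (x 1 - p 1) - s 1 * (x 0 - p 0) = 0 := by
    simp only [planeDet, Pi.sub_apply]
    exact_mod_cast Iff.rfl
  rw [hcast]
  constructor
  · rintro ⟨t, ht⟩
    have h0 := congrFun ht 0
    have h1 := congrFun ht 1
    simp only [castVec, Pi.add_apply, Pi.smul_apply, smul_eq_mul] at h0 h1
    rw [h0, h1]
    ring
  · intro h
    by_cases h0 : s 0 = 0
    · have h1 : s 1 ≠ 0 := fun h1 => hs (funext fun i => by fin_cases i <;> assumption)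
      have h1' : (s 1 : ℝ) ≠ 0 := by exact_mod_cast h1
      refine ⟨(x 1 - p 1) / s 1, funext fun i => ?_⟩
      fin_cases i <;> simp only [castVec, Pi.add_apply, Pi.smul_apply, smul_eq_mul,
        Fin.zero_eta, Fin.mk_one] <;> field_simp <;> linarith
    · have h0' : (s 0 : ℝ) ≠ 0 := by exact_mod_cast h0
      refine ⟨(x 0 - p 0) / s 0, funext fun i => ?_⟩
      fin_cases i <;> simp only [castVec, Pi.add_apply, Pi.smul_apply, smul_eq_mul,
        Fin.zero_eta, Fin.mk_one] <;> field_simp <;> linarith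

lemma PairwiseLinIndepZ.planeDet_ne_zero {m : ℕ} {s : Fin m → Fin 2 → ℤ}
    (h : PairwiseLinIndepZ s) (hs0 : ∀ i, s i ≠ 0) {i j : Fin m} (hij : i ≠ j) :
    planeDet (s i) (s j) ≠ 0 := by
  intro h0
  obtain ⟨t, ht⟩ := (castVec_mem_lineThrough_iff (hs0 j) 0 (s i)).2
    (by simp only [planeDet, sub_zero] at *; linarith)
  refine h i j hij t ?_
  rw [ht]
  funext k
  simp [castVec]

/-- Removing the common points of two finite sets with equal X-rays preserves equality. -/
lemma EqualXraysZ.card_filter_sdiff {F F' : Finset (Fin 2 → ℤ)} {s : Fin 2 → ℤ}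
    (h : EqualXraysZ (F : Set (Fin 2 → ℤ)) F' s) (hs : s ≠ 0) (x : Fin 2 → ℤ) :
    ((F \ F').filter fun y => planeDet s (y - x) = 0).card =
      ((F' \ F).filter fun y => planeDet s (y - x) = 0).card := by
  have hx := h (castVec x)
  simp only [castVec_mem_lineThrough_iff hs] at hx
  have e : ∀ G : Finset (Fin 2 → ℤ), {y | y ∈ (G : Set (Fin 2 → ℤ)) ∧ planeDet s (y - x) = 0} =
      ((G.filter fun y => planeDet s (y - x) = 0 : Finset _) : Set (Fin 2 → ℤ)) := fun G => by
    ext y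
    simp
  rw [e, e, Set.ncard_coe_finset, Set.ncard_coe_finset] at hx
  have split : ∀ G H : Finset (Fin 2 → ℤ), ((G \ H).filter fun y => planeDet s (y - x) = 0) =
      (G.filter fun y => planeDet s (y - x) = 0) \ (H.filter fun y => planeDet s (y - x) = 0) :=
    fun G H => by
      ext y
      simp only [Finset.mem_filter, Finset.mem_sdiff]
      tauto
  rw [split, split]
  exact Finset.card_sdiff_comm hx

/-- **Corollary 1 (strengthened Rényi theorem in `ℤ²`):** any `n`-point set in `ℤ²`
with `n = 5` or `n > 6` is uniquely determined by its X-rays taken from at least `n`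
pairwise linearly independent directions. -/
theorem strengthened_renyi_Z2 (n m : ℕ) (hn : n = 5 ∨ 6 < n) (hmn : n ≤ m)
    (F : Set (Fin 2 → ℤ)) (hF : F.Finite) (hFn : F.ncard = n)
    (F' : Set (Fin 2 → ℤ)) (hF' : F'.Finite)
    (s : Fin m → (Fin 2 → ℤ)) (hs0 : ∀ i, s i ≠ 0)
    (hind : PairwiseLinIndepZ s)
    (hxray : ∀ i, EqualXraysZ F F' (s i)) : F' = F := by
  lift F to Finset (Fin 2 → ℤ) using hF
  lift F' to Finset (Fin 2 → ℤ) using hF'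
  rw [Set.ncard_coe_finset] at hFn
  have hs : ∀ i j, i ≠ j → planeDet (s i) (s j) ≠ 0 := fun i j hij =>
    hind.planeDet_ne_zero hs0 hij
  have hx := fun i => (hxray i).card_filter_sdiff (hs0 i)
  have hle : (F \ F').card ≤ m := ((Finset.card_le_card Finset.sdiff_subset).trans_eq hFn).trans hmn
  rcases (F \ F').eq_empty_or_nonempty with hA | hA
  · have hB : (F' \ F).card = 0 := by
      rw [← card_eq_of_card_filter_eq (hx ⟨0, by omega⟩), hA, Finset.card_empty]
    rw [Finset.card_eq_zero, Finset.sdiff_eq_empty_iff_subset] at hB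
    rw [Finset.sdiff_eq_empty_iff_subset] at hA
    rw [hB.antisymm hA]
  · exfalso
    obtain ⟨hcard, hpart⟩ := card_eq_and_exists_partner hs
      disjoint_sdiff_sdiff hA hle hx
    obtain ⟨nx, h⟩ := exists_isXrayPolygon (A := ((F \ F' : Finset _) : Set (Fin 2 → ℤ)))
      (hA.mono Finset.subset_union_left) hs0 hs hcard (by simpa only [Finset.mem_coe] using hpart)
    obtain ⟨d, hd, k, hk⟩ := h.exists_card_dvd (by omega)
    have hAB := card_eq_of_card_filter_eq (hx ⟨0, by omega⟩)
    have hAn := Finset.card_le_card (Finset.sdiff_subset (s := F) (t := F'))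
    have hmle : m ≤ n := by
      rw [Finset.card_union_of_disjoint disjoint_sdiff_sdiff] at hcard
      omega
    obtain rfl : m = n := le_antisymm hmle hmn
    have hdvd : m ∣ d := ⟨k, by rw [hcard] at hk; linarith⟩
    have hmd := Nat.le_of_dvd (by omega) hdvd
    rcases hn with rfl | hn
    · rcases hd with rfl | rfl | rfl | rfl | rfl <;> omega
    · omega
end

section
/- (Unit-cube / Lorentz construction: ψ_{ℤ^d}(m) ≤ 2^{m−1}.) For all integers m ≥ d ≥ 2 there exist m pairwise linearly independent vectors s_1, …, s_m ∈ ℤ^d spanning ℝ^d and two distinct sets F, F' ⊆ ℤ^d with |F| = |F'| = 2^{m−1} that have equal X-rays in each of the directions s_1, …, s_m. -/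
open scoped symmDiff

/-- The point of the moment curve with parameter `2 ^ i`. -/
def momentVec (d : ℕ) (i : ℕ) : Fin d → ℤ := fun j => (2 ^ i) ^ (j : ℕ)

/-- The sum of a subfamily of vectors: a vertex of the projected unit cube. -/
def cubeVertex {d m : ℕ} (s : Fin m → (Fin d → ℤ)) (A : Finset (Fin m)) : Fin d → ℤ :=
  ∑ i ∈ A, s i

lemma castVec_add {d : ℕ} (x y : Fin d → ℤ) : castVec (x + y) = castVec x + castVec y := by
  ext j; simp [castVec]

lemma castVec_add_mem_lineThrough_iff {d : ℕ} (x s : Fin d → ℤ) (p : Fin d → ℝ) :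
    castVec (x + s) ∈ lineThrough p (castVec s) ↔ castVec x ∈ lineThrough p (castVec s) := by
  rw [castVec_add]
  constructor
  · rintro ⟨t, ht⟩
    refine ⟨t - 1, ?_⟩
    rw [sub_smul, one_smul, ← add_sub_assoc, ← ht, add_sub_cancel_right]
  · rintro ⟨t, ht⟩
    exact ⟨t + 1, by rw [ht, add_smul, one_smul, add_assoc]⟩

section Toggle

variable {α : Type*} [DecidableEq α]

lemma symmDiff_singleton_of_mem {A : Finset α} {i : α} (h : i ∈ A) :
    A ∆ {i} = A.erase i := by
  ext x; simp only [Finset.mem_symmDiff, Finset.mem_singleton, Finset.mem_erase]; grind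

lemma symmDiff_singleton_of_notMem {A : Finset α} {i : α} (h : i ∉ A) :
    A ∆ {i} = insert i A := by
  ext x; simp only [Finset.mem_symmDiff, Finset.mem_singleton, Finset.mem_insert]; grind

lemma even_card_symmDiff_singleton (A : Finset α) (i : α) :
    Even (A ∆ {i}).card ↔ ¬ Even A.card := by
  by_cases h : i ∈ A
  · rw [symmDiff_singleton_of_mem h, ← Finset.card_erase_add_one h, Nat.even_add_one, not_not]
  · rw [symmDiff_singleton_of_notMem h, Finset.card_insert_of_notMem h, Nat.even_add_one]

/-- Toggling the element `i` exchanges the sets of even and odd cardinality. -/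
lemma ncard_even_eq_ncard_odd (i : α) (P : Finset α → Prop)
    (hP : ∀ A, P (A ∆ {i}) ↔ P A) :
    {A : Finset α | Even A.card ∧ P A}.ncard = {A : Finset α | ¬ Even A.card ∧ P A}.ncard := by
  have hinv : Function.Involutive fun A : Finset α => A ∆ {i} :=
    fun A => symmDiff_symmDiff_cancel_right _ _
  rw [← Set.ncard_image_of_injective _ hinv.injective, hinv.image_eq_preimage_symm]
  congr 1
  ext A
  simp only [Set.mem_preimage, Set.mem_ofPred_eq, even_card_symmDiff_singleton, hP]

end Toggle

lemma ncard_even_add_ncard_odd (m : ℕ) :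
    {A : Finset (Fin m) | Even A.card}.ncard + {A : Finset (Fin m) | ¬ Even A.card}.ncard
      = 2 ^ m := by
  have h := Set.ncard_add_ncard_compl {A : Finset (Fin m) | Even A.card}
  rw [Set.compl_ofPred] at h
  simpa [Nat.card_eq_fintype_card] using h

lemma cubeVertex_toggle_mem_lineThrough_iff {d m : ℕ} (s : Fin m → (Fin d → ℤ)) (i : Fin m)
    (p : Fin d → ℝ) (A : Finset (Fin m)) :
    castVec (cubeVertex s (A ∆ {i})) ∈ lineThrough p (castVec (s i)) ↔
      castVec (cubeVertex s A) ∈ lineThrough p (castVec (s i)) := by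
  by_cases h : i ∈ A
  · rw [symmDiff_singleton_of_mem h, ← castVec_add_mem_lineThrough_iff, cubeVertex, cubeVertex,
      Finset.sum_erase_add _ _ h]
  · rw [symmDiff_singleton_of_notMem h, cubeVertex, Finset.sum_insert h, add_comm,
      castVec_add_mem_lineThrough_iff, cubeVertex]

lemma ncard_sep_image {α β : Type*} {f : α → β} (hf : Function.Injective f) (Q : α → Prop)
    (P : β → Prop) : {x ∈ f '' {a | Q a} | P x}.ncard = {a | Q a ∧ P (f a)}.ncard := by
  rw [← Set.ncard_image_of_injective _ hf]
  congr 1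
  ext x
  simp only [Set.mem_ofPred_eq, Set.mem_image]
  grind

/-- The even and the odd vertices of a cube have equal X-rays along its edges. -/
lemma equalXraysZ_cubeVertex {d m : ℕ} {s : Fin m → (Fin d → ℤ)}
    (hs : Function.Injective (cubeVertex s)) (i : Fin m) :
    EqualXraysZ (cubeVertex s '' {A | Even A.card}) (cubeVertex s '' {A | ¬ Even A.card})
      (s i) := by
  intro p
  rw [ncard_sep_image hs, ncard_sep_image hs]
  exact ncard_even_eq_ncard_odd i _ (cubeVertex_toggle_mem_lineThrough_iff s i p)

lemma injective_cubeVertex_momentVec {d : ℕ} (hd : 2 ≤ d) (m : ℕ) :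
    Function.Injective (cubeVertex fun i : Fin m => momentVec d i) := by
  intro A B h
  have h1 := congrFun h ⟨1, hd⟩
  simp only [cubeVertex, Finset.sum_apply, momentVec, pow_one] at h1
  apply Finset.map_injective Fin.valEmbedding
  apply Finset.geomSum_injective le_rfl
  simp only [Finset.sum_map, Fin.valEmbedding_apply]
  exact_mod_cast h1

lemma pairwiseLinIndepZ_momentVec {d : ℕ} (hd : 2 ≤ d) (m : ℕ) :
    PairwiseLinIndepZ fun i : Fin m => momentVec d i := by
  intro i j hij c h
  have h0 := congrFun h ⟨0, by omega⟩
  have h1 := congrFun h ⟨1, hd⟩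
  simp only [castVec, momentVec, Pi.smul_apply, smul_eq_mul, pow_zero, pow_one, Int.cast_one,
    mul_one] at h0 h1
  rw [← h0, one_mul] at h1
  exact hij (Fin.ext (Nat.pow_right_injective le_rfl (by exact_mod_cast h1)))

lemma span_castVec_momentVec {d m : ℕ} (hm : d ≤ m) :
    Submodule.span ℝ (Set.range fun i : Fin m => castVec (momentVec d i)) = ⊤ := by
  have hdet : (Matrix.vandermonde fun i : Fin d => (2 : ℝ) ^ (i : ℕ)).det ≠ 0 := by
    rw [Matrix.det_vandermonde_ne_zero_iff]
    intro i j h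
    simp only at h
    exact Fin.ext (Nat.pow_right_injective le_rfl (by exact_mod_cast h))
  have hspan := (Matrix.linearIndependent_rows_of_det_ne_zero hdet).span_eq_top_of_card_eq_finrank'
    (by simp)
  rw [eq_top_iff, ← hspan]
  apply Submodule.span_mono
  rintro _ ⟨i, rfl⟩
  refine ⟨Fin.castLE hm i, ?_⟩
  ext j
  simp [castVec, momentVec, Matrix.vandermonde]

/-- **Unit-cube (Lorentz) construction:** `ψ_{ℤ^d}(m) ≤ 2^{m-1}`: there exist `m`
pairwise linearly independent directions in `ℤ^d` spanning `ℝ^d` and two distinct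
sets of cardinality `2^{m-1}` with equal X-rays in these directions. -/
theorem cube_construction (d m : ℕ) (hd : 2 ≤ d) (hm : d ≤ m) :
    ∃ s : Fin m → (Fin d → ℤ),
      (∀ i, s i ≠ 0) ∧ PairwiseLinIndepZ s ∧
      Submodule.span ℝ (Set.range fun i => castVec (s i)) = ⊤ ∧
      ∃ F F' : Set (Fin d → ℤ), F.Finite ∧ F'.Finite ∧ F ≠ F' ∧
        F.ncard = 2 ^ (m - 1) ∧ F'.ncard = 2 ^ (m - 1) ∧
        ∀ i, EqualXraysZ F F' (s i) := by
  have hm0 : 0 < m := by omega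
  have hinj := injective_cubeVertex_momentVec hd m
  have heq : {A : Finset (Fin m) | Even A.card}.ncard
      = {A : Finset (Fin m) | ¬ Even A.card}.ncard := by
    simpa using ncard_even_eq_ncard_odd (⟨0, hm0⟩ : Fin m) (fun _ => True) (fun _ => Iff.rfl)
  have hadd := ncard_even_add_ncard_odd m
  have hpow : 2 ^ m = 2 * 2 ^ (m - 1) := by rw [← pow_succ', Nat.sub_add_cancel hm0]
  refine ⟨fun i => momentVec d i, fun i h => ?_, pairwiseLinIndepZ_momentVec hd m,
    span_castVec_momentVec hm, cubeVertex _ '' {A | Even A.card},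
    cubeVertex _ '' {A | ¬ Even A.card}, Set.toFinite _, Set.toFinite _, fun h => ?_, ?_, ?_,
    equalXraysZ_cubeVertex hinj⟩
  · simpa [momentVec] using congrFun h ⟨0, by omega⟩
  · have h' := hinj.image_injective h
    have hempty : (∅ : Finset (Fin m)) ∈ {A : Finset (Fin m) | Even A.card} := by simp
    rw [h'] at hempty
    simp at hempty
  · rw [Set.ncard_image_of_injective _ hinj]; omega
  · rw [Set.ncard_image_of_injective _ hinj]; omega
end
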